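/- arXiv:math/0303302 — 8 statements merged into one kernel-verified Lean document; each statement's English description precedes it below -/
import Mathlib

section
/- Let a, b, c, d be integers ≥ 2 and let f = z_0^a + z_1^b z_2 + z_2^c z_3 + z_1 z_3^d ∈ ℂ[z_0,z_1,z_2,z_3] (Type X of the classification). Then the Milnor number of f satisfies μ(f) = (a-1)bcd; that is, the complex dimension of ℂ[z_0,z_1,z_2,z_3]/(∂f/∂z_0, ∂f/∂z_1, ∂f/∂z_2, ∂f/∂z_3) equals (a-1)bcd. -/
open MvPolynomial

section Loop

variable {A : Type*} [CommRing A]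

/-- The normal form of `x ^ i * y ^ j * z ^ k` modulo the relations `x ^ b = -c y ^ (c - 1) z`,
`y ^ c = -d z ^ (d - 1) x`, `z ^ d = -b x ^ (b - 1) y`, as a multiple of a monomial whose
exponents lie in the box `i < b`, `j < c`, `k < d`. -/
def loopNormalForm (x y z : A) (b c d i j k : ℕ) : A :=
  if i < b ∧ j < c ∧ k < d then x ^ i * y ^ j * z ^ k
  else if b ≤ i ∧ i < 2 * b ∧ j = 0 ∧ k + 1 < d then
    -(c * (x ^ (i - b) * y ^ (c - 1) * z ^ (k + 1)))
  else if c ≤ j ∧ j < 2 * c ∧ k = 0 ∧ i + 1 < b then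
    -(d * (x ^ (i + 1) * y ^ (j - c) * z ^ (d - 1)))
  else if d ≤ k ∧ k < 2 * d ∧ i = 0 ∧ j + 1 < c then
    -(b * (x ^ (b - 1) * y ^ (j + 1) * z ^ (k - d)))
  else 0

theorem loopNormalForm_of_lt (x y z : A) {b c d i j k : ℕ} (hi : i < b) (hj : j < c)
    (hk : k < d) : loopNormalForm x y z b c d i j k = x ^ i * y ^ j * z ^ k :=
  if_pos ⟨hi, hj, hk⟩

theorem loopNormalForm_rotate (x y z : A) (b c d i j k : ℕ) :
    loopNormalForm x y z b c d i j k = loopNormalForm y z x c d b j k i := by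
  unfold loopNormalForm
  split_ifs <;> first | (exfalso; omega) | ring

theorem loopNormalForm_add_left (x y z : A) {b c d : ℕ} (hb : 2 ≤ b) (hc : 2 ≤ c)
    (i j k : ℕ) : loopNormalForm x y z b c d (i + b) j k =
      -(c * loopNormalForm x y z b c d i (j + (c - 1)) (k + 1)) := by
  by_cases h : j = 0 ∧ i < b ∧ k + 1 < d
  · obtain ⟨rfl, hi, hk⟩ := h
    rw [loopNormalForm_of_lt x y z hi (by omega : 0 + (c - 1) < c) hk, loopNormalForm,
      if_neg (by omega), if_pos (by omega)]
    simp
  · have h₁ : loopNormalForm x y z b c d (i + b) j k = 0 := by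
      unfold loopNormalForm
      rw [if_neg (by omega), if_neg (by omega), if_neg (by omega), if_neg (by omega)]
    have h₂ : loopNormalForm x y z b c d i (j + (c - 1)) (k + 1) = 0 := by
      unfold loopNormalForm
      rw [if_neg (by omega), if_neg (by omega), if_neg (by omega), if_neg (by omega)]
    rw [h₁, h₂, mul_zero, neg_zero]

theorem loop_monomial_eq_zero {x y z : A} {b c d : ℕ} (hb : b ≠ 0) (hc : c ≠ 0) (hd : d ≠ 0)
    (hu : IsUnit (1 + b * c * d : A))
    (hx : x ^ b = -(c * (y ^ (c - 1) * z))) (hy : y ^ c = -(d * (z ^ (d - 1) * x)))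
    (hz : z ^ d = -(b * (x ^ (b - 1) * y))) :
    x ^ b * y = 0 ∧ y ^ (c - 1) * z ^ d = 0 := by
  obtain ⟨b, rfl⟩ := Nat.exists_eq_succ_of_ne_zero hb
  obtain ⟨c, rfl⟩ := Nat.exists_eq_succ_of_ne_zero hc
  obtain ⟨d, rfl⟩ := Nat.exists_eq_succ_of_ne_zero hd
  simp only [Nat.succ_eq_add_one, Nat.add_sub_cancel] at *
  constructor
  · apply hu.mul_right_eq_zero.1
    generalize ((b + 1 : ℕ) : A) = β, ((c + 1 : ℕ) : A) = γ, ((d + 1 : ℕ) : A) = δ at *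
    linear_combination y * hx - γ * z * hy + γ * δ * x * hz
  · apply hu.mul_right_eq_zero.1
    generalize ((b + 1 : ℕ) : A) = β, ((c + 1 : ℕ) : A) = γ, ((d + 1 : ℕ) : A) = δ at *
    linear_combination y ^ c * hz - β * x ^ b * hy + β * δ * z ^ d * hx

theorem loop_monomial_eq_normalForm {x y z : A} {b c d : ℕ} (hb : 2 ≤ b) (hc : 2 ≤ c)
    (hd : 2 ≤ d) (hu : IsUnit (1 + b * c * d : A))
    (hx : x ^ b = -(c * (y ^ (c - 1) * z))) (hy : y ^ c = -(d * (z ^ (d - 1) * x)))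
    (hz : z ^ d = -(b * (x ^ (b - 1) * y))) (i j k : ℕ) :
    x ^ i * y ^ j * z ^ k = loopNormalForm x y z b c d i j k := by
  have hu' : IsUnit (1 + c * d * b : A) := by convert hu using 1; ring
  have hu'' : IsUnit (1 + d * b * c : A) := by convert hu using 1; ring
  obtain ⟨x₁, yz⟩ := loop_monomial_eq_zero (by omega) (by omega) (by omega) hu hx hy hz
  obtain ⟨y₁, zx⟩ := loop_monomial_eq_zero (by omega) (by omega) (by omega) hu' hy hz hx
  obtain ⟨z₁, xy⟩ := loop_monomial_eq_zero (by omega) (by omega) (by omega) hu'' hz hx hy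
  have square {u v w : A} {p q r : ℕ} (hq : 2 ≤ q) (huv : u ^ p * v = 0)
      (h : u ^ p = -(q * (v ^ (q - 1) * w))) : u ^ (2 * p) = 0 := by
    obtain ⟨q, rfl⟩ := Nat.exists_eq_add_of_le' hq
    simp only [show q + 2 - 1 = q + 1 by omega] at h
    linear_combination u ^ p * h - (q + 2 : ℕ) * v ^ q * w * huv
  have x₂ := square (r := d) hc x₁ hx
  have y₂ := square (r := b) hd y₁ hy
  have z₂ := square (r := c) hb z₁ hz
  have vanish {m : A} (hm : m = 0) (h : m ∣ x ^ i * y ^ j * z ^ k) :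
      x ^ i * y ^ j * z ^ k = 0 := by
    rwa [hm, zero_dvd_iff] at h
  have dvd {i' j' k' : ℕ} (hi : i' ≤ i) (hj : j' ≤ j) (hk : k' ≤ k) :
      x ^ i' * y ^ j' * z ^ k' ∣ x ^ i * y ^ j * z ^ k :=
    mul_dvd_mul (mul_dvd_mul (pow_dvd_pow _ hi) (pow_dvd_pow _ hj)) (pow_dvd_pow _ hk)
  unfold loopNormalForm
  split_ifs with h₀ h₁ h₂ h₃
  · rfl
  · obtain ⟨i, rfl⟩ := Nat.exists_eq_add_of_le h₁.1
    rw [Nat.add_sub_cancel_left, h₁.2.2.1]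
    linear_combination x ^ i * z ^ k * hx
  · obtain ⟨j, rfl⟩ := Nat.exists_eq_add_of_le h₂.1
    rw [Nat.add_sub_cancel_left, h₂.2.2.1]
    linear_combination x ^ i * y ^ j * hy
  · obtain ⟨k, rfl⟩ := Nat.exists_eq_add_of_le h₃.1
    rw [Nat.add_sub_cancel_left, h₃.2.2.1]
    linear_combination z ^ k * y ^ j * hz
  · rcases (by omega : (b ≤ i ∧ 1 ≤ j) ∨ (c ≤ j ∧ 1 ≤ k) ∨ (d ≤ k ∧ 1 ≤ i) ∨
      2 * b ≤ i ∨ 2 * c ≤ j ∨ 2 * d ≤ k ∨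
      (c - 1 ≤ j ∧ d ≤ k) ∨ (d - 1 ≤ k ∧ b ≤ i) ∨ (b - 1 ≤ i ∧ c ≤ j)) with
      h | h | h | h | h | h | h | h | h
    · exact vanish (m := x ^ b * y ^ 1 * z ^ 0) (by simp [x₁]) (dvd h.1 h.2 (by omega))
    · exact vanish (m := x ^ 0 * y ^ c * z ^ 1) (by simp [y₁]) (dvd (by omega) h.1 h.2)
    · exact vanish (m := x ^ 1 * y ^ 0 * z ^ d) (by linear_combination z₁)
        (dvd h.2 (by omega) h.1)
    · exact vanish (m := x ^ (2 * b) * y ^ 0 * z ^ 0) (by simp [x₂])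
        (dvd h (by omega) (by omega))
    · exact vanish (m := x ^ 0 * y ^ (2 * c) * z ^ 0) (by simp [y₂])
        (dvd (by omega) h (by omega))
    · exact vanish (m := x ^ 0 * y ^ 0 * z ^ (2 * d)) (by simp [z₂])
        (dvd (by omega) (by omega) h)
    · exact vanish (m := x ^ 0 * y ^ (c - 1) * z ^ d) (by simp [yz])
        (dvd (by omega) h.1 h.2)
    · exact vanish (m := x ^ b * y ^ 0 * z ^ (d - 1)) (by linear_combination zx)
        (dvd h.2 (by omega) h.1)
    · exact vanish (m := x ^ (b - 1) * y ^ c * z ^ 0) (by simp [xy])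
        (dvd h.1 h.2 (by omega))

theorem map_loopNormalForm {B F : Type*} [CommRing B] [FunLike F A B] [RingHomClass F A B]
    (φ : F) (x y z : A) (b c d i j k : ℕ) :
    φ (loopNormalForm x y z b c d i j k) =
      loopNormalForm (φ x) (φ y) (φ z) b c d i j k := by
  simp only [loopNormalForm, apply_ite φ, map_neg, map_mul, map_pow, map_natCast, map_zero]

end Loop

section Reduction

variable {K : Type*} [Field K]

/-- The linear endomorphism of `K[X₀, X₁, X₂, X₃]` sending each monomial to its normal form modulo
`X₀ ^ n` and the three relations of `loopNormalForm`. -/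
noncomputable def loopReduction (K : Type*) [Field K] (n b c d : ℕ) :
    MvPolynomial (Fin 4) K →ₗ[K] MvPolynomial (Fin 4) K :=
  (basisMonomials (Fin 4) K).constr K fun u =>
    if u 0 < n then X 0 ^ u 0 * loopNormalForm (X 1) (X 2) (X 3) b c d (u 1) (u 2) (u 3) else 0

/-- The monomial of `K[X₀, X₁, X₂, X₃]` with the given exponents. -/
noncomputable def monomialOfExponents (K : Type*) [Field K] (p : ℕ × ℕ × ℕ × ℕ) :
    MvPolynomial (Fin 4) K :=
  X 0 ^ p.1 * (X 1 ^ p.2.1 * X 2 ^ p.2.2.1 * X 3 ^ p.2.2.2)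

theorem monomial_one_eq_monomialOfExponents (u : Fin 4 →₀ ℕ) :
    monomial u (1 : K) = monomialOfExponents K (u 0, u 1, u 2, u 3) := by
  rw [monomial_eq, Finsupp.prod_fintype _ _ (by simp), Fin.prod_univ_four]
  simp only [monomialOfExponents, map_one]
  ring

theorem monomialOfExponents_eq_basisMonomials (p : ℕ × ℕ × ℕ × ℕ) :
    monomialOfExponents K p = basisMonomials (Fin 4) K
      (Finsupp.equivFunOnFinite.symm ![p.1, p.2.1, p.2.2.1, p.2.2.2]) := by
  rw [coe_basisMonomials]
  simp [monomial_one_eq_monomialOfExponents]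

theorem linearIndependent_monomialOfExponents :
    LinearIndependent K (monomialOfExponents K) := by
  have h : monomialOfExponents K = basisMonomials (Fin 4) K ∘ fun p : ℕ × ℕ × ℕ × ℕ =>
      Finsupp.equivFunOnFinite.symm ![p.1, p.2.1, p.2.2.1, p.2.2.2] :=
    funext monomialOfExponents_eq_basisMonomials
  rw [h]
  refine (basisMonomials (Fin 4) K).linearIndependent.comp _ fun p q hpq => ?_
  have := Finsupp.equivFunOnFinite.symm.injective hpq
  simpa [Prod.ext_iff, and_assoc] using this

theorem loopReduction_monomialOfExponents (n b c d : ℕ) (p : ℕ × ℕ × ℕ × ℕ) :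
    loopReduction K n b c d (monomialOfExponents K p) =
      if p.1 < n then
        X 0 ^ p.1 * loopNormalForm (X 1) (X 2) (X 3) b c d p.2.1 p.2.2.1 p.2.2.2
      else 0 := by
  rw [monomialOfExponents_eq_basisMonomials, loopReduction, Module.Basis.constr_basis]
  simp

theorem linearMap_eq_of_monomialOfExponents {M : Type*} [AddCommMonoid M] [Module K M]
    {φ ψ : MvPolynomial (Fin 4) K →ₗ[K] M}
    (h : ∀ p, φ (monomialOfExponents K p) = ψ (monomialOfExponents K p)) : φ = ψ := by
  refine (basisMonomials (Fin 4) K).ext fun u => ?_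
  rw [coe_basisMonomials]
  simpa only [monomial_one_eq_monomialOfExponents] using h _

/-- Exponents of the monomials fixed by `loopReduction`. -/
def loopBox (n b c d : ℕ) : Finset (ℕ × ℕ × ℕ × ℕ) :=
  Finset.range n ×ˢ Finset.range b ×ˢ Finset.range c ×ˢ Finset.range d

theorem range_loopReduction {n b c d : ℕ} (hb : b ≠ 0) (hc : c ≠ 0) (hd : d ≠ 0) :
    LinearMap.range (loopReduction K n b c d) =
      Submodule.span K (monomialOfExponents K '' loopBox n b c d) := by
  have mem {l i j k : ℕ} (hl : l < n) (hi : i < b) (hj : j < c) (hk : k < d) :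
      X 0 ^ l * (X 1 ^ i * X 2 ^ j * X 3 ^ k) ∈
        Submodule.span K (monomialOfExponents K '' loopBox n b c d) :=
    Submodule.subset_span ⟨(l, i, j, k), by simp [loopBox, *], rfl⟩
  have mem' {l i j k : ℕ} (m : ℕ) (hl : l < n) (hi : i < b) (hj : j < c) (hk : k < d) :
      X 0 ^ l * -((m : MvPolynomial (Fin 4) K) * (X 1 ^ i * X 2 ^ j * X 3 ^ k)) ∈
        Submodule.span K (monomialOfExponents K '' loopBox n b c d) := by
    convert neg_mem (nsmul_mem (mem hl hi hj hk) m) using 1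
    rw [nsmul_eq_mul]
    ring
  apply le_antisymm
  · rw [LinearMap.range_eq_map, ← (basisMonomials (Fin 4) K).span_eq, Submodule.map_span,
      Submodule.span_le]
    rintro _ ⟨_, ⟨u, rfl⟩, rfl⟩
    simp only [coe_basisMonomials, monomial_one_eq_monomialOfExponents,
      loopReduction_monomialOfExponents, SetLike.mem_coe, loopNormalForm]
    split_ifs
    · exact mem (by omega) (by omega) (by omega) (by omega)
    · exact mem' _ (by omega) (by omega) (by omega) (by omega)
    · exact mem' _ (by omega) (by omega) (by omega) (by omega)
    · exact mem' _ (by omega) (by omega) (by omega) (by omega)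
    all_goals simp
  · rw [Submodule.span_le]
    rintro _ ⟨p, hp, rfl⟩
    simp only [loopBox, Finset.coe_product, Set.mem_prod, Finset.coe_range, Set.mem_Iio] at hp
    refine ⟨monomialOfExponents K p, ?_⟩
    rw [loopReduction_monomialOfExponents, if_pos hp.1,
      loopNormalForm_of_lt _ _ _ hp.2.1 hp.2.2.1 hp.2.2.2, monomialOfExponents]

theorem finrank_range_loopReduction {b c d : ℕ} (hb : b ≠ 0) (hc : c ≠ 0) (hd : d ≠ 0)
    (n : ℕ) :
    Module.finrank K (LinearMap.range (loopReduction K n b c d)) = n * (b * c * d) := by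
  classical
  have h := linearIndependent_monomialOfExponents (K := K)
  rw [range_loopReduction hb hc hd, ← Finset.coe_image, finrank_span_finset_eq_card,
    Finset.card_image_of_injective _ h.injective]
  · simp [loopBox, mul_assoc]
  · rw [Finset.coe_image]
    exact (h.linearIndepOn (loopBox n b c d : Set _)).id_image

/-- The ideal generators defining the quotient on which `loopReduction` computes normal forms. -/
noncomputable def loopRelations (K : Type*) [Field K] (n b c d : ℕ) :
    Fin 4 → MvPolynomial (Fin 4) K :=
  ![X 0 ^ n, X 3 ^ d + (b : MvPolynomial (Fin 4) K) * (X 1 ^ (b - 1) * X 2),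
    X 1 ^ b + (c : MvPolynomial (Fin 4) K) * (X 2 ^ (c - 1) * X 3),
    X 2 ^ c + (d : MvPolynomial (Fin 4) K) * (X 3 ^ (d - 1) * X 1)]

theorem loopReduction_mul_eq_zero {n b c d : ℕ} (hb : 2 ≤ b) (hc : 2 ≤ c) (hd : 2 ≤ d)
    (q : MvPolynomial (Fin 4) K) (m : Fin 4) :
    loopReduction K n b c d (q * loopRelations K n b c d m) = 0 := by
  have reduce (g : MvPolynomial (Fin 4) K)
      (h : ∀ p, loopReduction K n b c d (monomialOfExponents K p * g) = 0) :
      loopReduction K n b c d (q * g) = 0 :=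
    LinearMap.congr_fun (linearMap_eq_of_monomialOfExponents
      (φ := loopReduction K n b c d ∘ₗ LinearMap.mulRight K g) (ψ := 0) h) q
  apply reduce
  rintro ⟨l, i, j, k⟩
  fin_cases m
  · change loopReduction K n b c d (monomialOfExponents K (l, i, j, k) * X 0 ^ n) = 0
    rw [show monomialOfExponents K (l, i, j, k) * X 0 ^ n =
        monomialOfExponents K (l + n, i, j, k) by simp only [monomialOfExponents]; ring,
      loopReduction_monomialOfExponents, if_neg (by simp)]
  · convert_to loopReduction K n b c d (monomialOfExponents K (l, i, j, k + d) +
      b • monomialOfExponents K (l, i + (b - 1), j + 1, k)) = 0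
    · congr 1
      simp only [loopRelations, monomialOfExponents, nsmul_eq_mul, Fin.reduceFinMk,
        Matrix.cons_val]
      ring
    rw [map_add, map_nsmul, loopReduction_monomialOfExponents, loopReduction_monomialOfExponents]
    dsimp only
    rw [← loopNormalForm_rotate (X 3), loopNormalForm_add_left _ _ _ hd hb, loopNormalForm_rotate]
    split_ifs
    · rw [nsmul_eq_mul]; ring
    · simp
  · convert_to loopReduction K n b c d (monomialOfExponents K (l, i + b, j, k) +
      c • monomialOfExponents K (l, i, j + (c - 1), k + 1)) = 0
    · congr 1
      simp only [loopRelations, monomialOfExponents, nsmul_eq_mul, Fin.reduceFinMk,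
        Matrix.cons_val]
      ring
    rw [map_add, map_nsmul, loopReduction_monomialOfExponents, loopReduction_monomialOfExponents]
    dsimp only
    rw [loopNormalForm_add_left _ _ _ hb hc]
    split_ifs
    · rw [nsmul_eq_mul]; ring
    · simp
  · convert_to loopReduction K n b c d (monomialOfExponents K (l, i, j + c, k) +
      d • monomialOfExponents K (l, i + 1, j, k + (d - 1))) = 0
    · congr 1
      simp only [loopRelations, monomialOfExponents, nsmul_eq_mul, Fin.reduceFinMk,
        Matrix.cons_val]
      ring
    rw [map_add, map_nsmul, loopReduction_monomialOfExponents, loopReduction_monomialOfExponents]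
    dsimp only
    rw [loopNormalForm_rotate, loopNormalForm_add_left _ _ _ hc hd, ← loopNormalForm_rotate]
    split_ifs
    · rw [nsmul_eq_mul]; ring
    · simp

theorem ker_loopReduction {n b c d : ℕ} (hb : 2 ≤ b) (hc : 2 ≤ c) (hd : 2 ≤ d)
    (hu : (1 + b * c * d : K) ≠ 0) {I : Ideal (MvPolynomial (Fin 4) K)}
    (hI : I = Ideal.span (Set.range (loopRelations K n b c d))) :
    LinearMap.ker (loopReduction K n b c d) = I.restrictScalars K := by
  apply le_antisymm
  · have mk_comp : (Ideal.Quotient.mkₐ K I).toLinearMap ∘ₗ loopReduction K n b c d =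
        (Ideal.Quotient.mkₐ K I).toLinearMap := by
      have rel (m : Fin 4) : Ideal.Quotient.mkₐ K I (loopRelations K n b c d m) = 0 :=
        Ideal.Quotient.eq_zero_iff_mem.2 (hI ▸ Ideal.subset_span ⟨m, rfl⟩)
      have h₀ : Ideal.Quotient.mkₐ K I (X 0 ^ n) = 0 := rel 0
      have h₃ := rel 1
      have h₁ := rel 2
      have h₂ := rel 3
      simp only [loopRelations, Matrix.cons_val] at h₁ h₂ h₃
      simp only [map_add, map_mul, map_pow, map_natCast] at h₀ h₁ h₂ h₃
      have unit : IsUnit (1 + b * c * d : MvPolynomial (Fin 4) K ⧸ I) := by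
        simpa using hu.isUnit.map (algebraMap K (MvPolynomial (Fin 4) K ⧸ I))
      refine linearMap_eq_of_monomialOfExponents fun p => ?_
      rw [LinearMap.comp_apply, loopReduction_monomialOfExponents, AlgHom.toLinearMap_apply,
        AlgHom.toLinearMap_apply, monomialOfExponents]
      split_ifs with hp
      · rw [map_mul, map_mul, map_loopNormalForm, ← loop_monomial_eq_normalForm hb hc hd unit
          (eq_neg_of_add_eq_zero_left h₁) (eq_neg_of_add_eq_zero_left h₂)
          (eq_neg_of_add_eq_zero_left h₃)]
        simp only [map_mul, map_pow]
      · rw [map_zero, map_mul, map_pow, pow_eq_zero_of_le (not_lt.1 hp) h₀, zero_mul]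
    intro q hq
    have := LinearMap.congr_fun mk_comp q
    rw [LinearMap.comp_apply, LinearMap.mem_ker.1 hq, map_zero] at this
    exact Ideal.Quotient.eq_zero_iff_mem.1 this.symm
  · intro g hg
    rw [Submodule.restrictScalars_mem, hI] at hg
    suffices ∀ q, loopReduction K n b c d (q * g) = 0 by simpa using this 1
    induction hg using Submodule.span_induction with
    | mem g hg =>
      intro q
      obtain ⟨m, rfl⟩ := hg
      exact loopReduction_mul_eq_zero hb hc hd q m
    | zero => simp
    | add g h _ _ hg hh => simp [mul_add, hg, hh]
    | smul r g _ hg => intro q; rw [smul_eq_mul, ← mul_assoc]; exact hg _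

theorem finrank_loop_quotient {n b c d : ℕ} (hb : 2 ≤ b) (hc : 2 ≤ c) (hd : 2 ≤ d)
    (hu : (1 + b * c * d : K) ≠ 0) {I : Ideal (MvPolynomial (Fin 4) K)}
    (hI : I = Ideal.span (Set.range (loopRelations K n b c d))) :
    Module.finrank K (MvPolynomial (Fin 4) K ⧸ I) = n * (b * c * d) := by
  rw [← finrank_range_loopReduction (K := K) (by omega) (by omega) (by omega) n,
    ← (loopReduction K n b c d).quotKerEquivRange.finrank_eq,
    (Submodule.quotEquivOfEq _ _ (ker_loopReduction hb hc hd hu hI)).finrank_eq]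
  exact (Submodule.Quotient.restrictScalarsEquiv K I).finrank_eq.symm

end Reduction

/-- Milnor number formula for Type X:  for `f = z_0^a + z_1^b z_2 + z_2^c z_3 + z_1 z_3^d`
with `a, b, c, d ≥ 2`, the complex dimension of the Milnor algebra equals `(a-1)bcd`. -/
theorem milnor_number_type_X
    (a b c d : ℕ) (ha : 2 ≤ a) (hb : 2 ≤ b) (hc : 2 ≤ c) (hd : 2 ≤ d) :
    Module.finrank ℂ
      (MvPolynomial (Fin 4) ℂ ⧸
        Ideal.span (Set.range fun i : Fin 4 =>
          pderiv i (X 0 ^ a + X 1 ^ b * X 2 + X 2 ^ c * X 3 + X 1 * X 3 ^ d :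
            MvPolynomial (Fin 4) ℂ)))
      = (a - 1) * (b * c * d) := by
  refine finrank_loop_quotient hb hc hd (by norm_cast; omega) ?_
  have ha' : IsUnit (a : MvPolynomial (Fin 4) ℂ) := by
    have : IsUnit (a : ℂ) := (Nat.cast_ne_zero.2 (by omega)).isUnit
    simpa using this.map (C : ℂ →+* MvPolynomial (Fin 4) ℂ)
  obtain ⟨u, hu⟩ := ha'
  have h (i : Fin 4) : pderiv i (X 0 ^ a + X 1 ^ b * X 2 + X 2 ^ c * X 3 + X 1 * X 3 ^ d :
      MvPolynomial (Fin 4) ℂ) =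
        (![u, 1, 1, 1] i : (MvPolynomial (Fin 4) ℂ)ˣ) * loopRelations ℂ (a - 1) b c d i := by
    fin_cases i
    all_goals simp [loopRelations, pderiv_X, hu]
    all_goals ring
  apply le_antisymm <;> rw [Ideal.span_le] <;> rintro _ ⟨i, rfl⟩
  · dsimp only
    rw [h]
    exact Ideal.mul_mem_left _ _ (Ideal.subset_span ⟨i, rfl⟩)
  · rw [SetLike.mem_coe, ← Ideal.unit_mul_mem_iff_mem _ (Units.isUnit (![u, 1, 1, 1] i)), ← h]
    exact Ideal.subset_span ⟨i, rfl⟩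
end

section
/- Let a, b, c, d be integers with 2 ≤ a ≤ b ≤ c ≤ d. Then 1/a + 1/b + 1/c + 1/d > 1 if and only if one of the following holds: (a,b) = (2,2); (a,b,c) = (2,3,3); (a,b,c) = (2,3,4); (a,b,c) = (2,3,5); (a,b,c) = (2,3,6); (a,b,c) = (2,3,7) and 7 ≤ d ≤ 41; (a,b,c) = (2,3,8) and 8 ≤ d ≤ 23; (a,b,c) = (2,3,9) and 9 ≤ d ≤ 17; (a,b,c) = (2,3,10) and 10 ≤ d ≤ 14; (a,b,c) = (2,3,11) and 11 ≤ d ≤ 13; (a,b,c) = (2,4,4); (a,b,c) = (2,4,5) and 5 ≤ d ≤ 19; (a,b,c) = (2,4,6) and 6 ≤ d ≤ 11; (a,b,c) = (2,4,7) and 7 ≤ d ≤ 9; (a,b,c) = (2,5,5) and 5 ≤ d ≤ 9; (a,b,c) = (2,5,6) and 6 ≤ d ≤ 7; (a,b,c) = (3,3,3); (a,b,c) = (3,3,4) and 4 ≤ d ≤ 11; (a,b,c) = (3,3,5) and 5 ≤ d ≤ 7; (a,b,c) = (3,4,4) and 4 ≤ d ≤ 5. -/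
/-- The reciprocals of four positive integers sum to more than one iff the inequality obtained by
clearing denominators holds. -/
theorem one_lt_sum_inv_four_iff {a b c d : ℕ} (ha : 0 < a) (hb : 0 < b) (hc : 0 < c)
    (hd : 0 < d) :
    (1 : ℚ) < 1 / a + 1 / b + 1 / c + 1 / d ↔
      a * b * c * d < b * c * d + a * c * d + a * b * d + a * b * c := by
  have hsum : (1 : ℚ) / a + 1 / b + 1 / c + 1 / d =
      (b * c * d + a * c * d + a * b * d + a * b * c) / (a * b * c * d) := by
    field_simp
  rw [hsum, one_lt_div (by positivity)]
  exact_mod_cast Iff.rfl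

/-- Replacing the largest denominator by the next smaller one only increases the sum. -/
theorem mul_lt_of_four_reciprocals {a b c d : ℕ} (hcd : c ≤ d)
    (h : a * b * c * d < b * c * d + a * c * d + a * b * d + a * b * c) :
    a * b * c < b * c + a * c + 2 * (a * b) := by
  have : a * b * c ≤ a * b * d := Nat.mul_le_mul_left _ hcd
  refine lt_of_mul_lt_mul_right (a := d) ?_ (Nat.zero_le d)
  linarith

/-- Replacing the largest of three denominators by the next smaller one only increases the sum. -/
theorem mul_lt_of_three_reciprocals {a b c : ℕ} (hbc : b ≤ c)
    (h : a * b * c < b * c + a * c + 2 * (a * b)) : a * b < b + 3 * a := by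
  have : a * b ≤ a * c := Nat.mul_le_mul_left _ hbc
  refine lt_of_mul_lt_mul_right (a := c) ?_ (Nat.zero_le c)
  linarith


/-- Part (I) of Theorem 3.3 (normalized with `a ≤ b ≤ c ≤ d`): the rationality criterion
`1/a + 1/b + 1/c + 1/d > 1` holds exactly for the listed families. -/
theorem type_I_rationality_classification
    (a b c d : ℕ) (ha : 2 ≤ a) (hab : a ≤ b) (hbc : b ≤ c) (hcd : c ≤ d) :
    (1 : ℚ) < 1 / a + 1 / b + 1 / c + 1 / d ↔
      (a = 2 ∧ b = 2) ∨
      (a = 2 ∧ b = 3 ∧ c = 3) ∨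
      (a = 2 ∧ b = 3 ∧ c = 4) ∨
      (a = 2 ∧ b = 3 ∧ c = 5) ∨
      (a = 2 ∧ b = 3 ∧ c = 6) ∨
      (a = 2 ∧ b = 3 ∧ c = 7 ∧ 7 ≤ d ∧ d ≤ 41) ∨
      (a = 2 ∧ b = 3 ∧ c = 8 ∧ 8 ≤ d ∧ d ≤ 23) ∨
      (a = 2 ∧ b = 3 ∧ c = 9 ∧ 9 ≤ d ∧ d ≤ 17) ∨
      (a = 2 ∧ b = 3 ∧ c = 10 ∧ 10 ≤ d ∧ d ≤ 14) ∨
      (a = 2 ∧ b = 3 ∧ c = 11 ∧ 11 ≤ d ∧ d ≤ 13) ∨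
      (a = 2 ∧ b = 4 ∧ c = 4) ∨
      (a = 2 ∧ b = 4 ∧ c = 5 ∧ 5 ≤ d ∧ d ≤ 19) ∨
      (a = 2 ∧ b = 4 ∧ c = 6 ∧ 6 ≤ d ∧ d ≤ 11) ∨
      (a = 2 ∧ b = 4 ∧ c = 7 ∧ 7 ≤ d ∧ d ≤ 9) ∨
      (a = 2 ∧ b = 5 ∧ c = 5 ∧ 5 ≤ d ∧ d ≤ 9) ∨
      (a = 2 ∧ b = 5 ∧ c = 6 ∧ 6 ≤ d ∧ d ≤ 7) ∨
      (a = 3 ∧ b = 3 ∧ c = 3) ∨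
      (a = 3 ∧ b = 3 ∧ c = 4 ∧ 4 ≤ d ∧ d ≤ 11) ∨
      (a = 3 ∧ b = 3 ∧ c = 5 ∧ 5 ≤ d ∧ d ≤ 7) ∨
      (a = 3 ∧ b = 4 ∧ c = 4 ∧ 4 ≤ d ∧ d ≤ 5) := by
  rw [one_lt_sum_inv_four_iff (by omega) (by omega) (by omega) (by omega)]
  by_cases h22 : a = 2 ∧ b = 2
  · refine iff_of_true ?_ (Or.inl h22)
    obtain ⟨rfl, rfl⟩ := h22
    linarith
  by_cases hbound : a ≤ 3 ∧ b ≤ 5 ∧ c ≤ 11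
  · obtain ⟨ha3, hb5, hc11⟩ := hbound
    interval_cases a <;> interval_cases b <;> interval_cases c <;> simp at h22 ⊢ <;> omega
  refine iff_of_false (fun h => hbound ?_) (by omega)
  have hc := mul_lt_of_four_reciprocals hcd h
  have hb := mul_lt_of_three_reciprocals hbc hc
  have ha3 : a ≤ 3 := by
    by_contra! ha4
    have : 4 * b ≤ a * b := Nat.mul_le_mul_right _ ha4
    omega
  have hb5 : b ≤ 5 := by interval_cases a <;> omega
  refine ⟨ha3, hb5, ?_⟩
  interval_cases a <;> interval_cases b <;> omega
end

section
/- Let a, b, c, d be integers ≥ 2 with a ≤ b, c ≤ d, and (a,b) lexicographically ≤ (c,d) (i.e., a < c, or a = c and b ≤ d). Then (a+b-2)/(ab-1) + (c+d-2)/(cd-1) > 1 if and only if one of the following holds: (a,b) = (2,2) and ((c,d) = (2,s) with s ≥ 2, or (c,d) = (3,s) with s ≥ 3, or (c,d) = (4,u) with 4 ≤ u ≤ 6); (a,b) = (2,r) with r ≥ 3 and (c,d) = (2,s) with s ≥ r; (a,b) = (2,3) and (c,d) = (3,u) with 3 ≤ u ≤ 6; (a,b) = (2,4) and (c,d) = (3,4);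 (a,b) = (2,s) with s ≥ 4 and (c,d) = (3,3); (a,b) = (2,5) and (c,d) = (3,4). -/
/-- Clearing denominators in the Type VI rationality criterion. -/
theorem one_lt_typeVI_iff {a b c d : ℕ} (ha : 2 ≤ a) (hb : 2 ≤ b) (hc : 2 ≤ c) (hd : 2 ≤ d) :
    (1 : ℚ) < ((a : ℚ) + b - 2) / ((a : ℚ) * b - 1) + ((c : ℚ) + d - 2) / ((c : ℚ) * d - 1) ↔
      ((a : ℤ) * b - 1) * ((c : ℤ) * d - 1) <
        ((a : ℤ) + b - 2) * ((c : ℤ) * d - 1) + ((a : ℤ) * b - 1) * ((c : ℤ) + d - 2) := by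
  have pos : ∀ {m n : ℕ}, 2 ≤ m → 2 ≤ n → (0 : ℚ) < (m : ℚ) * n - 1 := by
    intro m n hm hn
    have hm' : (2 : ℚ) ≤ m := by exact_mod_cast hm
    have hn' : (2 : ℚ) ≤ n := by exact_mod_cast hn
    nlinarith
  have hab := pos ha hb
  have hcd := pos hc hd
  rw [div_add_div _ _ hab.ne' hcd.ne', one_lt_div (mul_pos hab hcd)]
  exact_mod_cast Iff.rfl

/-- The contribution of a pair with both entries at least `3` is at most `1 / 2`. -/
theorem two_mul_add_sub_two_le {m n : ℤ} (hm : 3 ≤ m) (hn : 3 ≤ n) :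
    2 * (m + n - 2) ≤ m * n - 1 := by
  nlinarith [mul_nonneg (sub_nonneg.2 hm) (sub_nonneg.2 hn)]

/-- The contribution of a pair with both entries at least `4` is at most `2 / 5`. -/
theorem five_mul_add_sub_two_le {m n : ℤ} (hm : 4 ≤ m) (hn : 4 ≤ n) :
    5 * (m + n - 2) ≤ 2 * (m * n - 1) := by
  nlinarith [mul_nonneg (sub_nonneg.2 hm) (sub_nonneg.2 hn)]

/-- Part (VI) of Theorem 3.3 (normalized with `a ≤ b`, `c ≤ d`, `(a,b)` lexicographically
`≤ (c,d)`): the Type VI rationality criterion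
`(a+b-2)/(ab-1) + (c+d-2)/(cd-1) > 1` holds exactly for the listed families. -/
theorem type_VI_rationality_classification
    (a b c d : ℕ) (ha : 2 ≤ a) (hb : 2 ≤ b) (hc : 2 ≤ c) (hd : 2 ≤ d)
    (hab : a ≤ b) (hcd : c ≤ d) (hlex : a < c ∨ (a = c ∧ b ≤ d)) :
    (1 : ℚ) < ((a : ℚ) + b - 2) / ((a : ℚ) * b - 1) + ((c : ℚ) + d - 2) / ((c : ℚ) * d - 1) ↔
      (a = 2 ∧ b = 2 ∧ ((c = 2 ∧ 2 ≤ d) ∨ (c = 3 ∧ 3 ≤ d) ∨ (c = 4 ∧ 4 ≤ d ∧ d ≤ 6))) ∨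
      (a = 2 ∧ 3 ≤ b ∧ c = 2 ∧ b ≤ d) ∨
      (a = 2 ∧ b = 3 ∧ c = 3 ∧ 3 ≤ d ∧ d ≤ 6) ∨
      (a = 2 ∧ b = 4 ∧ c = 3 ∧ d = 4) ∨
      (a = 2 ∧ 4 ≤ b ∧ c = 3 ∧ d = 3) ∨
      (a = 2 ∧ b = 5 ∧ c = 3 ∧ d = 4) := by
  rw [one_lt_typeVI_iff ha hb hc hd]
  rcases Nat.lt_or_ge 2 a with ha3 | ha2
  · have hP := two_mul_add_sub_two_le (m := a) (n := b) (by omega) (by omega)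
    have hQ := two_mul_add_sub_two_le (m := c) (n := d) (by omega) (by omega)
    have hp : (0 : ℤ) ≤ (a : ℤ) * b - 1 := by linarith
    have hq : (0 : ℤ) ≤ (c : ℤ) * d - 1 := by linarith
    refine iff_of_false (not_lt.2 ?_) (by omega)
    nlinarith [mul_le_mul_of_nonneg_right hP hq, mul_le_mul_of_nonneg_left hQ hp]
  obtain rfl : a = 2 := by omega
  rcases (by omega : c = 2 ∨ c = 3 ∨ 4 ≤ c) with rfl | rfl | hc4
  · refine iff_of_true ?_ (by omega)
    push_cast
    nlinarith
  · rcases (by omega : b = 2 ∨ b = 3 ∨ b = 4 ∨ b = 5 ∨ 6 ≤ b) with rfl | rfl | rfl | rfl | hb6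
    · omega
    · omega
    · omega
    · omega
    rcases hcd.eq_or_lt with rfl | hd4
    · omega
    · refine iff_of_false (not_lt.2 ?_) (by omega)
      push_cast
      have hb6' : (6 : ℤ) ≤ b := by exact_mod_cast hb6
      have hd4' : (4 : ℤ) ≤ d := by exact_mod_cast hd4
      nlinarith [mul_nonneg (sub_nonneg.2 hb6') (sub_nonneg.2 hd4')]
  rcases hb.eq_or_lt with rfl | hb3
  · rcases hc4.eq_or_lt with rfl | hc5
    · omega
    · refine iff_of_false (not_lt.2 ?_) (by omega)
      have hc5' : (5 : ℤ) ≤ c := by exact_mod_cast hc5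
      have hd5' : (5 : ℤ) ≤ d := by omega
      push_cast
      nlinarith [mul_nonneg (sub_nonneg.2 hc5') (sub_nonneg.2 hd5')]
  · refine iff_of_false (not_lt.2 ?_) (by omega)
    push_cast
    have hb3' : (3 : ℤ) ≤ b := by exact_mod_cast hb3
    have hQ := five_mul_add_sub_two_le (m := c) (n := d) (by omega) (by omega)
    have hq : (0 : ℤ) ≤ (c : ℤ) * d - 1 := by
      have : (4 : ℤ) ≤ c := by exact_mod_cast hc4
      nlinarith
    have hp : (0 : ℤ) ≤ 2 * (b : ℤ) - 1 := by linarith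
    nlinarith [mul_le_mul_of_nonneg_left hQ hp, mul_nonneg (sub_nonneg.2 hb3') hq]
end

section
/- Let a, b, c, d be positive integers belonging to one of the following families: (1) b = 1, a,c,d ≥ 2; (2) b = 1, d = 1, c ≥ a ≥ 2; (3) {a,b} = {2,2} and {c,d} = {r,s} with (r,s) = (2,s), s ≥ 2, or (3,s), s ≥ 3, or (4,s), s ≥ 4, or (5,u), 5 ≤ u ≤ 15, or (6,u), 6 ≤ u ≤ 9, or (7,7); (4) {a,b} = {2,r}, {c,d} = {2,s} with r ≥ 3, s ≥ r; (5) {a,b} = {2,3} and {c,d} = {3,s}, s ≥ 3, or {4,u}, 4 ≤ u ≤ 8, or {5,5}; (6) {a,b} = {2,4}, {c,d} = {3,u}, 4 ≤ u ≤ 15; (7) {a,b} = {2,5}, {c,d} = {3,u}, 5 ≤ u ≤ 9; (8) {a,b} = {2,6}, {c,d} = {3,u}, u ∈ {6,7}; (9) {a,b} = {2,s}, s ≥ 4, {c,d} = {3,3}; (10) {a,b} = {2,s}, s ≥ 5, {c,d} = {3,4}; (11) {a,b} = {2,u}, 6 ≤ u ≤ 14, {c,d} = {3,5}; (12) {a,b}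 = {2,u}, u ∈ {7,8}, {c,d} = {3,6}; (13) {a,b} = {2,4}, {c,d} = {4,u}, u ∈ {4,5}; (14) {a,b} = {2,u}, u ∈ {5,6,7}, {c,d} = {4,4}; (15) {a,b} = {3,3}, {c,d} = {3,u}, u ∈ {3,4,5}. Then (a+b-1)/(ab) + (c+d-1)/(cd) > 1. -/
/-- `{a, b} = {x, y}` as unordered pairs. -/
def UPair (a b x y : ℕ) : Prop := (a = x ∧ b = y) ∨ (a = y ∧ b = x)

theorem UPair.refl (a b : ℕ) : UPair a b a b := Or.inl ⟨rfl, rfl⟩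

/-- The rationality criterion after clearing denominators; it depends only on the unordered pairs
`{a, b}` and `{c, d}`. -/
theorem one_lt_add_div_of_UPair {a b c d x y z w : ℕ} (ha : 1 ≤ a) (hb : 1 ≤ b) (hc : 1 ≤ c)
    (hd : 1 ≤ d) (hab : UPair a b x y) (hcd : UPair c d z w)
    (h : x * y * (z * w) + z * w + x * y < (x + y) * (z * w) + (z + w) * (x * y)) :
    (1 : ℚ) < ((a : ℚ) + b - 1) / ((a : ℚ) * b) + ((c : ℚ) + d - 1) / ((c : ℚ) * d) := by
  have habcd : a * b * (c * d) + c * d + a * b < (a + b) * (c * d) + (c + d) * (a * b) := by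
    rcases hab with ⟨rfl, rfl⟩ | ⟨rfl, rfl⟩ <;> rcases hcd with ⟨rfl, rfl⟩ | ⟨rfl, rfl⟩ <;> linarith
  have hpos : (0 : ℚ) < (a : ℚ) * b := by positivity
  have hpos' : (0 : ℚ) < (c : ℚ) * d := by positivity
  rw [div_add_div _ _ hpos.ne' hpos'.ne', lt_div_iff₀ (mul_pos hpos hpos')]
  have hq : (a : ℚ) * b * (c * d) + c * d + a * b < (a + b) * (c * d) + (c + d) * (a * b) := by
    exact_mod_cast habcd
  linarith

/-- Part (IV) of Theorem 3.3: every parameter tuple `(a,b,c,d)` listed for Type IV,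
`f = x^a + x y^b + z^c + z w^d`, satisfies the rationality criterion
`α(1,1,1,1) = (a+b-1)/(ab) + (c+d-1)/(cd) > 1`. -/
theorem type_IV_parameters_rational
    (a b c d : ℕ) (ha : 1 ≤ a) (hb : 1 ≤ b) (hc : 1 ≤ c) (hd : 1 ≤ d)
    (hfam :
      (b = 1 ∧ 2 ≤ a ∧ 2 ≤ c ∧ 2 ≤ d) ∨
      (b = 1 ∧ d = 1 ∧ 2 ≤ a ∧ a ≤ c) ∨
      (a = 2 ∧ b = 2 ∧
        ((∃ s, 2 ≤ s ∧ UPair c d 2 s) ∨ (∃ s, 3 ≤ s ∧ UPair c d 3 s) ∨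
         (∃ s, 4 ≤ s ∧ UPair c d 4 s) ∨ (∃ u, 5 ≤ u ∧ u ≤ 15 ∧ UPair c d 5 u) ∨
         (∃ u, 6 ≤ u ∧ u ≤ 9 ∧ UPair c d 6 u) ∨ UPair c d 7 7)) ∨
      (∃ r s, 3 ≤ r ∧ r ≤ s ∧ UPair a b 2 r ∧ UPair c d 2 s) ∨
      (UPair a b 2 3 ∧
        ((∃ s, 3 ≤ s ∧ UPair c d 3 s) ∨ (∃ u, 4 ≤ u ∧ u ≤ 8 ∧ UPair c d 4 u) ∨
         UPair c d 5 5)) ∨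
      (UPair a b 2 4 ∧ ∃ u, 4 ≤ u ∧ u ≤ 15 ∧ UPair c d 3 u) ∨
      (UPair a b 2 5 ∧ ∃ u, 5 ≤ u ∧ u ≤ 9 ∧ UPair c d 3 u) ∨
      (UPair a b 2 6 ∧ (UPair c d 3 6 ∨ UPair c d 3 7)) ∨
      ((∃ s, 4 ≤ s ∧ UPair a b 2 s) ∧ c = 3 ∧ d = 3) ∨
      ((∃ s, 5 ≤ s ∧ UPair a b 2 s) ∧ UPair c d 3 4) ∨
      ((∃ u, 6 ≤ u ∧ u ≤ 14 ∧ UPair a b 2 u) ∧ UPair c d 3 5) ∨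
      ((UPair a b 2 7 ∨ UPair a b 2 8) ∧ UPair c d 3 6) ∨
      (UPair a b 2 4 ∧ (UPair c d 4 4 ∨ UPair c d 4 5)) ∨
      ((UPair a b 2 5 ∨ UPair a b 2 6 ∨ UPair a b 2 7) ∧ c = 4 ∧ d = 4) ∨
      (a = 3 ∧ b = 3 ∧ (UPair c d 3 3 ∨ UPair c d 3 4 ∨ UPair c d 3 5))) :
    (1 : ℚ) < ((a : ℚ) + b - 1) / ((a : ℚ) * b) + ((c : ℚ) + d - 1) / ((c : ℚ) * d) := by
  rcases hfam with ⟨rfl, h2a, h2c, h2d⟩ | ⟨rfl, rfl, h2a, hac⟩ | ⟨rfl, rfl, h⟩ |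
    ⟨r, s, hr, hrs, hab, hcd⟩ | ⟨hab, h⟩ | ⟨hab, u, hu, hu', hcd⟩ | ⟨hab, u, hu, hu', hcd⟩ |
    ⟨hab, hcd | hcd⟩ | ⟨⟨s, hs, hab⟩, rfl, rfl⟩ | ⟨⟨s, hs, hab⟩, hcd⟩ |
    ⟨⟨u, hu, hu', hab⟩, hcd⟩ | ⟨hab | hab, hcd⟩ | ⟨hab, hcd | hcd⟩ | ⟨hab | hab | hab, rfl, rfl⟩ |
    ⟨rfl, rfl, hcd | hcd | hcd⟩
  case inl => exact one_lt_add_div_of_UPair ha hb hc hd (.refl _ _) (.refl _ _) (by nlinarith)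
  case inr.inl => exact one_lt_add_div_of_UPair ha hb hc hd (.refl _ _) (.refl _ _) (by nlinarith)
  case inr.inr.inl =>
    rcases h with ⟨s, hs, hcd⟩ | ⟨s, hs, hcd⟩ | ⟨s, hs, hcd⟩ | ⟨u, hu, hu', hcd⟩ |
      ⟨u, hu, hu', hcd⟩ | hcd <;>
    exact one_lt_add_div_of_UPair ha hb hc hd (.refl _ _) hcd (by linarith)
  case inr.inr.inr.inl => exact one_lt_add_div_of_UPair ha hb hc hd hab hcd (by nlinarith)
  case inr.inr.inr.inr.inl =>
    rcases h with ⟨s, hs, hcd⟩ | ⟨u, hu, hu', hcd⟩ | hcd <;>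
    exact one_lt_add_div_of_UPair ha hb hc hd hab hcd (by linarith)
  all_goals first
    | exact one_lt_add_div_of_UPair ha hb hc hd hab hcd (by linarith)
    | exact one_lt_add_div_of_UPair ha hb hc hd hab (.refl _ _) (by linarith)
    | exact one_lt_add_div_of_UPair ha hb hc hd (.refl _ _) hcd (by linarith)
end

section
/- Let a, b, c, d be positive integers belonging to one of the following families: (1) d = 1, a ≥ 2, b ≥ a, c ≥ 2; (2) (a,b) = (2,2) and {c,d} = {2,s}, s ≥ 2, or {3,s}, s ≥ 3, or {4,u}, 4 ≤ u ≤ 8, or {5,5}; (3) (a,b) = (2,r), r ≥ 3, {c,d} = {2,s}, s ≥ r; (4) (a,b) = (2,s), {c,d} = {2,r}, r ≥ 2, s ≥ r+1; (5) {c,d} = {2,2} and (a,b) = (3,s), s ≥ 3, or (4,s), s ≥ 4, or (5,u), 5 ≤ u ≤ 12, or (6,u), 6 ≤ u ≤ 8; (6) (a,b) = (2,3) and {c,d} = {3,u}, 3 ≤ u ≤ 9, or {4,4}; (7) (a,b) = (2,4), {c,d} = {3,u}, u ∈ {4,5,6}; (8) (a,b) = (2,5), {c,d} = {3,5}; (9)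 (a,b) = (2,s), s ≥ 4, {c,d} = {3,3}; (10) (a,b) = (2,s), s ≥ 5, {c,d} = {3,4}; (11) (a,b) = (2,u), u ∈ {6,7}, {c,d} = {3,5}; (12) (a,b) = (3,r) and {c,d} = {2,s} with (r,s) = (3,s), s ≥ 3, or (4,u), 4 ≤ u ≤ 10, or (5,u), u ∈ {5,6}; (13) (a,b) = (3,s) and {c,d} = {2,r} with (s,r) = (s,3), s ≥ 4, or (u,4), 5 ≤ u ≤ 10, or (6,5); (14) (a,b) = (4,u), u ∈ {4,5,6}, {c,d} = {2,3}; (15) (a,b) = (2,4), {c,d} = {4,4}; (16) (a,b) = (4,4), {c,d} = {2,4}; (17) (a,b) = (3,3), {c,d} = {3,3}; (18) (a,b) = (3,4), {c,d} = {3,3}. Then (a+b-2)/(ab-1) + (c+d-1)/(cd) > 1. -/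
/-- The rationality criterion for Type V with denominators cleared. -/
theorem one_lt_div_add_div_of_int_lt {a b c d : ℕ} (hab : 1 < a * b) (hc : 1 ≤ c) (hd : 1 ≤ d)
    (h : (c : ℤ) * d * (a * b - 1) < c * d * (a + b - 2) + (c + d - 1) * (a * b - 1)) :
    (1 : ℚ) < ((a : ℚ) + b - 2) / ((a : ℚ) * b - 1) + ((c : ℚ) + d - 1) / ((c : ℚ) * d) := by
  have hab' : (0 : ℚ) < (a : ℚ) * b - 1 := sub_pos.mpr (by exact_mod_cast hab)
  have hcd' : (0 : ℚ) < (c : ℚ) * d := by positivity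
  have h' : (c : ℚ) * d * (a * b - 1) < c * d * (a + b - 2) + (c + d - 1) * (a * b - 1) := by
    exact_mod_cast h
  rw [div_add_div _ _ hab'.ne' hcd'.ne', one_lt_div (mul_pos hab' hcd')]
  linarith

/-- Part (V) of Theorem 3.3: every parameter tuple `(a,b,c,d)` listed for Type V,
`f = x^a y + x y^b + z^c + z w^d`, satisfies the rationality criterion
`α(1,1,1,1) = (a+b-2)/(ab-1) + (c+d-1)/(cd) > 1`. -/
theorem type_V_parameters_rational
    (a b c d : ℕ) (ha : 1 ≤ a) (hb : 1 ≤ b) (hc : 1 ≤ c) (hd : 1 ≤ d)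
    (hfam :
      (d = 1 ∧ 2 ≤ a ∧ a ≤ b ∧ 2 ≤ c) ∨
      (a = 2 ∧ b = 2 ∧
        ((∃ s, 2 ≤ s ∧ UPair c d 2 s) ∨ (∃ s, 3 ≤ s ∧ UPair c d 3 s) ∨
         (∃ u, 4 ≤ u ∧ u ≤ 8 ∧ UPair c d 4 u) ∨ UPair c d 5 5)) ∨
      (a = 2 ∧ 3 ≤ b ∧ ∃ s, b ≤ s ∧ UPair c d 2 s) ∨
      (a = 2 ∧ ∃ r, 2 ≤ r ∧ r + 1 ≤ b ∧ UPair c d 2 r) ∨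
      (((a = 3 ∧ 3 ≤ b) ∨ (a = 4 ∧ 4 ≤ b) ∨ (a = 5 ∧ 5 ≤ b ∧ b ≤ 12) ∨
        (a = 6 ∧ 6 ≤ b ∧ b ≤ 8)) ∧ c = 2 ∧ d = 2) ∨
      (a = 2 ∧ b = 3 ∧ ((∃ u, 3 ≤ u ∧ u ≤ 9 ∧ UPair c d 3 u) ∨ UPair c d 4 4)) ∨
      (a = 2 ∧ b = 4 ∧ (UPair c d 3 4 ∨ UPair c d 3 5 ∨ UPair c d 3 6)) ∨
      (a = 2 ∧ b = 5 ∧ UPair c d 3 5) ∨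
      (a = 2 ∧ 4 ≤ b ∧ c = 3 ∧ d = 3) ∨
      (a = 2 ∧ 5 ≤ b ∧ UPair c d 3 4) ∨
      (a = 2 ∧ (b = 6 ∨ b = 7) ∧ UPair c d 3 5) ∨
      (a = 3 ∧ ((b = 3 ∧ ∃ s, 3 ≤ s ∧ UPair c d 2 s) ∨
        (b = 4 ∧ ∃ u, 4 ≤ u ∧ u ≤ 10 ∧ UPair c d 2 u) ∨
        (b = 5 ∧ (UPair c d 2 5 ∨ UPair c d 2 6)))) ∨
      (a = 3 ∧ ((4 ≤ b ∧ UPair c d 2 3) ∨ (5 ≤ b ∧ b ≤ 10 ∧ UPair c d 2 4) ∨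
        (b = 6 ∧ UPair c d 2 5))) ∨
      (a = 4 ∧ (b = 4 ∨ b = 5 ∨ b = 6) ∧ UPair c d 2 3) ∨
      (a = 2 ∧ b = 4 ∧ c = 4 ∧ d = 4) ∨
      (a = 4 ∧ b = 4 ∧ UPair c d 2 4) ∨
      (a = 3 ∧ b = 3 ∧ c = 3 ∧ d = 3) ∨
      (a = 3 ∧ b = 4 ∧ c = 3 ∧ d = 3)) :
    (1 : ℚ) < ((a : ℚ) + b - 2) / ((a : ℚ) * b - 1) + ((c : ℚ) + d - 1) / ((c : ℚ) * d) := by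
  have ha2 : 2 ≤ a := by omega
  have hb2 : 2 ≤ b := by omega
  apply one_lt_div_add_div_of_int_lt (by nlinarith) hc hd
  rcases hfam with ⟨rfl, -, -, -⟩ | hfam
  · have hpos : (0 : ℤ) < c * (a + b - 2) := mul_pos (by omega) (by omega)
    push_cast
    linarith
  · unfold UPair at hfam
    rcases hfam with
      ⟨rfl, rfl, ⟨s, hs, h⟩ | ⟨s, hs, h⟩ | ⟨u, hu, hu', h⟩ | h⟩ | ⟨rfl, h3, s, hs, h⟩ |
      ⟨rfl, r, hr, hb', h⟩ |
      ⟨⟨rfl, h⟩ | ⟨rfl, h⟩ | ⟨rfl, h⟩ | ⟨rfl, h⟩, rfl, rfl⟩ |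
      ⟨rfl, rfl, ⟨u, hu, hu', h⟩ | h⟩ | ⟨rfl, rfl, h | h | h⟩ | ⟨rfl, rfl, h⟩ |
      ⟨rfl, h, rfl, rfl⟩ | ⟨rfl, h5, h⟩ | ⟨rfl, rfl | rfl, h⟩ |
      ⟨rfl, ⟨rfl, s, hs, h⟩ | ⟨rfl, u, hu, hu', h⟩ | ⟨rfl, h | h⟩⟩ |
      ⟨rfl, ⟨h4, h⟩ | ⟨h5, h10, h⟩ | ⟨rfl, h⟩⟩ | ⟨rfl, rfl | rfl | rfl, h⟩ |
      ⟨rfl, rfl, rfl, rfl⟩ | ⟨rfl, rfl, h⟩ | ⟨rfl, rfl, rfl, rfl⟩ | ⟨rfl, rfl, rfl, rfl⟩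
    all_goals
      try rcases h with ⟨rfl, rfl⟩ | ⟨rfl, rfl⟩
    all_goals push_cast <;> ring_nf <;> omega
end

section
/- Let a, b, c, d be positive integers belonging to one of the following families: (1) a ≥ 2, b = 1, and either c,d ≥ 2 or c = 1 (with d ≥ 1 arbitrary); (2) a = 2, (b,c,d) = (2,r,s), r,s ≥ 2; (3) (b,c,d) = (2,2,s) and (a,s) = (3,s), s ≥ 3, or (4,s), s ≥ 4, or (5,u), 5 ≤ u ≤ 10, or (6,6); (4) (b,c,d) = (2,2,r) and (a,r) = (a,2), a ≥ 3, or (u,3), 4 ≤ u ≤ 12, or (u,4), 5 ≤ u ≤ 8, or (6,5); (5) a = 2, (b,c,d) = (3,r,s) with (r,s) = (3,s), s ≥ 3, or (4,s), s ≥ 4, or (5,u), 5 ≤ u ≤ 18, or (6,u), 6 ≤ u ≤ 11, or (7,u), u ∈ {7,8}; (6) a = 2, (b,c,d) = (3,s,r) with (s,r) = (s,4), s ≥ 5, or (u,5), 6 ≤ u ≤ 18, or (u,6), 7 ≤ u ≤ 11, or (8,7); (7) a = 3, (b,c,d) = (2,r,s) with (r,s) = (3,s), s ≥ 3, or (4,u),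 4 ≤ u ≤ 12, or (5,u), u ∈ {5,6,7}, or (6,6); (8) a = 3, (b,c,d) = (2,s,r) with (s,r) = (s,3), s ≥ 4, or (u,4), 5 ≤ u ≤ 12, or (u,5), u ∈ {6,7}; (9) a = 4, (b,c,d) = (2,3,u), u ∈ {4,5,6}; (10) a = 4, (b,c,d) = (2,u,3), u ∈ {4,5,6}; (11) a ∈ {4,5,6}, (b,c,d) = (2,3,3); (12) a = 2, (b,c,d) = (4,4,u), 4 ≤ u ≤ 10, or (4,5,u), u ∈ {5,6}, or (4,6,5); (13) a = 4, (b,c,d) = (2,4,4); (14) a = 3, (b,c,d) = (3,3,u), u ∈ {3,4,5}. Then 1/a + (bc + cd + db - b - c - d + 3)/(bcd + 1) > 1. -/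
/-- Part (X) of Theorem 3.3: every parameter tuple `(a,b,c,d)` listed for Type X,
`f = x^a + y^b z + z^c w + y w^d`, satisfies the rationality criterion
`α(1,1,1,1) = 1/a + (bc + cd + db - b - c - d + 3)/(bcd + 1) > 1`. -/
theorem type_X_parameters_rational
    (a b c d : ℕ) (ha : 1 ≤ a) (hb : 1 ≤ b) (hc : 1 ≤ c) (hd : 1 ≤ d)
    (hfam :
      (2 ≤ a ∧ b = 1 ∧ ((2 ≤ c ∧ 2 ≤ d) ∨ c = 1)) ∨
      (a = 2 ∧ b = 2 ∧ 2 ≤ c ∧ 2 ≤ d) ∨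
      (b = 2 ∧ c = 2 ∧ ((a = 3 ∧ 3 ≤ d) ∨ (a = 4 ∧ 4 ≤ d) ∨
        (a = 5 ∧ 5 ≤ d ∧ d ≤ 10) ∨ (a = 6 ∧ d = 6))) ∨
      (b = 2 ∧ c = 2 ∧ ((3 ≤ a ∧ d = 2) ∨ (4 ≤ a ∧ a ≤ 12 ∧ d = 3) ∨
        (5 ≤ a ∧ a ≤ 8 ∧ d = 4) ∨ (a = 6 ∧ d = 5))) ∨
      (a = 2 ∧ b = 3 ∧ ((c = 3 ∧ 3 ≤ d) ∨ (c = 4 ∧ 4 ≤ d) ∨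
        (c = 5 ∧ 5 ≤ d ∧ d ≤ 18) ∨ (c = 6 ∧ 6 ≤ d ∧ d ≤ 11) ∨
        (c = 7 ∧ (d = 7 ∨ d = 8)))) ∨
      (a = 2 ∧ b = 3 ∧ ((5 ≤ c ∧ d = 4) ∨ (6 ≤ c ∧ c ≤ 18 ∧ d = 5) ∨
        (7 ≤ c ∧ c ≤ 11 ∧ d = 6) ∨ (c = 8 ∧ d = 7))) ∨
      (a = 3 ∧ b = 2 ∧ ((c = 3 ∧ 3 ≤ d) ∨ (c = 4 ∧ 4 ≤ d ∧ d ≤ 12) ∨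
        (c = 5 ∧ (d = 5 ∨ d = 6 ∨ d = 7)) ∨ (c = 6 ∧ d = 6))) ∨
      (a = 3 ∧ b = 2 ∧ ((4 ≤ c ∧ d = 3) ∨ (5 ≤ c ∧ c ≤ 12 ∧ d = 4) ∨
        ((c = 6 ∨ c = 7) ∧ d = 5))) ∨
      (a = 4 ∧ b = 2 ∧ c = 3 ∧ (d = 4 ∨ d = 5 ∨ d = 6)) ∨
      (a = 4 ∧ b = 2 ∧ (c = 4 ∨ c = 5 ∨ c = 6) ∧ d = 3) ∨
      ((a = 4 ∨ a = 5 ∨ a = 6) ∧ b = 2 ∧ c = 3 ∧ d = 3) ∨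
      (a = 2 ∧ b = 4 ∧ ((c = 4 ∧ 4 ≤ d ∧ d ≤ 10) ∨ (c = 5 ∧ (d = 5 ∨ d = 6)) ∨
        (c = 6 ∧ d = 5))) ∨
      (a = 4 ∧ b = 2 ∧ c = 4 ∧ d = 4) ∨
      (a = 3 ∧ b = 3 ∧ c = 3 ∧ (d = 3 ∨ d = 4 ∨ d = 5))) :
    (1 : ℚ) < 1 / a +
      ((b : ℚ) * c + (c : ℚ) * d + (d : ℚ) * b - b - c - d + 3) / ((b : ℚ) * c * d + 1) := by
  have key : a * (b + c + d) + a * (b * c * d + 1) <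
      a * (b * c + c * d + d * b + 3) + (b * c * d + 1) := by
    rcases hfam with ⟨_, rfl, _⟩ | ⟨rfl, rfl, _⟩ | ⟨rfl, rfl, h⟩ | ⟨rfl, rfl, h⟩ |
      ⟨rfl, rfl, h⟩ | ⟨rfl, rfl, h⟩ | ⟨rfl, rfl, h⟩ | ⟨rfl, rfl, h⟩ | ⟨rfl, rfl, rfl, h⟩ |
      ⟨rfl, rfl, h, rfl⟩ | ⟨h, rfl, rfl, rfl⟩ | ⟨rfl, rfl, h⟩ | ⟨rfl, rfl, rfl, rfl⟩ |
      ⟨rfl, rfl, rfl, h⟩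
    · nlinarith
    · nlinarith
    · rcases h with ⟨rfl, _⟩ | ⟨rfl, _⟩ | ⟨rfl, _⟩ | ⟨rfl, _⟩ <;> omega
    · rcases h with ⟨_, rfl⟩ | ⟨_, _, rfl⟩ | ⟨_, _, rfl⟩ | ⟨_, rfl⟩ <;> omega
    · rcases h with ⟨rfl, _⟩ | ⟨rfl, _⟩ | ⟨rfl, _⟩ | ⟨rfl, _⟩ | ⟨rfl, _⟩ <;> omega
    · rcases h with ⟨_, rfl⟩ | ⟨_, _, rfl⟩ | ⟨_, _, rfl⟩ | ⟨_, rfl⟩ <;> omega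
    · rcases h with ⟨rfl, _⟩ | ⟨rfl, _⟩ | ⟨rfl, _⟩ | ⟨rfl, _⟩ <;> omega
    · rcases h with ⟨_, rfl⟩ | ⟨_, _, rfl⟩ | ⟨_, rfl⟩ <;> omega
    · omega
    · omega
    · omega
    · rcases h with ⟨rfl, _⟩ | ⟨rfl, _⟩ | ⟨rfl, _⟩ <;> omega
    · omega
    · omega
  have ha' : (0 : ℚ) < a := by exact_mod_cast ha
  have hD : (0 : ℚ) < (b : ℚ) * c * d + 1 := by positivity
  have keyQ : (a : ℚ) * (b + c + d) + a * (b * c * d + 1) <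
      a * (b * c + c * d + d * b + 3) + (b * c * d + 1) := by exact_mod_cast key
  rw [div_add_div _ _ ha'.ne' hD.ne', lt_div_iff₀ (mul_pos ha' hD)]
  linarith
end

section
/- Let a, b, c, d be positive integers with a ≥ 2, belonging to one of the following families: (1) at least one of b, c, d equals 1; (2) a = 2 and {b,c,d} = {2,2,s}, s ≥ 2, or {b,c,d} = {2,3,u}, u ∈ {3,4,5}; (3) a = r ≥ 3 and {b,c,d} = {2,2,s}, s ≥ r; (4) {b,c,d} = {2,2,r}, r ≥ 2, a ≥ r+1; (5) a = 3 and {b,c,d} = {2,3,u}, u ∈ {3,4,5}; (6) a = 4 and {b,c,d} = {2,3,u}, u ∈ {4,5}; (7) a = 5 and {b,c,d} = {2,3,5}; (8) a ≥ 4 and {b,c,d} = {2,3,3}; (9) a ≥ 5 and {b,c,d} = {2,3,4}; (10) a ≥ 6 and {b,c,d} = {2,3,5}. Then 1/a + (a-1)/(ab) + (a-1)/(ac) + (a-1)/(ad) > 1. -/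
/-- `{b, c, d} = {x, y, z}` as unordered triples (multisets). -/
def UTriple (b c d x y z : ℕ) : Prop := ({b, c, d} : Multiset ℕ) = ({x, y, z} : Multiset ℕ)

theorem UTriple.sum_inv_eq {b c d x y z : ℕ} (h : UTriple b c d x y z) :
    (b : ℚ)⁻¹ + (c : ℚ)⁻¹ + (d : ℚ)⁻¹ = (x : ℚ)⁻¹ + (y : ℚ)⁻¹ + (z : ℚ)⁻¹ := by
  have h' := congrArg (fun m : Multiset ℕ => (m.map fun n : ℕ => (n : ℚ)⁻¹).sum) h
  simpa [add_assoc] using h'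

theorem UTriple.one_lt_sum_inv_of_two_two {b c d s : ℕ} (hs : 0 < s) (h : UTriple b c d 2 2 s) :
    (1 : ℚ) < (b : ℚ)⁻¹ + (c : ℚ)⁻¹ + (d : ℚ)⁻¹ := by
  have hs' : (0 : ℚ) < (s : ℚ)⁻¹ := by positivity
  rw [h.sum_inv_eq]
  push_cast
  linarith

theorem UTriple.one_lt_sum_inv_of_two_three {b c d u : ℕ} (hu : 0 < u) (hu' : u < 6)
    (h : UTriple b c d 2 3 u) : (1 : ℚ) < (b : ℚ)⁻¹ + (c : ℚ)⁻¹ + (d : ℚ)⁻¹ := by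
  rw [h.sum_inv_eq]
  interval_cases u <;> norm_num

theorem one_lt_sum_inv_of_eq_one {b c d : ℕ} (hb : 1 ≤ b) (hc : 1 ≤ c) (hd : 1 ≤ d)
    (h : b = 1 ∨ c = 1 ∨ d = 1) : (1 : ℚ) < (b : ℚ)⁻¹ + (c : ℚ)⁻¹ + (d : ℚ)⁻¹ := by
  have hb' : (0 : ℚ) < (b : ℚ)⁻¹ := by positivity
  have hc' : (0 : ℚ) < (c : ℚ)⁻¹ := by positivity
  have hd' : (0 : ℚ) < (d : ℚ)⁻¹ := by positivity
  rcases h with rfl | rfl | rfl <;> rw [Nat.cast_one, inv_one] <;> linarith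

/-- The value `α(1,1,1,1)` is a proper convex combination of `1` and `1/b + 1/c + 1/d`. -/
theorem one_lt_weight_sum_of_one_lt_sum_inv {a b c d : ℚ} (ha : 1 < a)
    (h : 1 < b⁻¹ + c⁻¹ + d⁻¹) :
    1 < 1 / a + (a - 1) / (a * b) + (a - 1) / (a * c) + (a - 1) / (a * d) := by
  have ha₀ : a ≠ 0 := by positivity
  have hpos : 0 < (a - 1) / a * (b⁻¹ + c⁻¹ + d⁻¹ - 1) :=
    mul_pos (div_pos (by linarith) (by linarith)) (by linarith)
  have hone : (a - 1) / a = 1 - 1 / a := by field_simp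
  simp only [← div_div, div_eq_mul_inv _ b, div_eq_mul_inv _ c, div_eq_mul_inv _ d]
  linarith

/-- Part (XIV) of Theorem 3.3: every parameter tuple `(a,b,c,d)` listed for Type XIV,
`f = x^a + x y^b + x z^c + x w^d + y^p z^q + z^r w^s`, satisfies the rationality criterion
`α(1,1,1,1) = 1/a + (a-1)/(ab) + (a-1)/(ac) + (a-1)/(ad) > 1`. -/
theorem type_XIV_parameters_rational
    (a b c d : ℕ) (ha : 2 ≤ a) (hb : 1 ≤ b) (hc : 1 ≤ c) (hd : 1 ≤ d)
    (hfam :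
      (b = 1 ∨ c = 1 ∨ d = 1) ∨
      (a = 2 ∧ ((∃ s, 2 ≤ s ∧ UTriple b c d 2 2 s) ∨ UTriple b c d 2 3 3 ∨
        UTriple b c d 2 3 4 ∨ UTriple b c d 2 3 5)) ∨
      (3 ≤ a ∧ ∃ s, a ≤ s ∧ UTriple b c d 2 2 s) ∨
      (∃ r, 2 ≤ r ∧ r + 1 ≤ a ∧ UTriple b c d 2 2 r) ∨
      (a = 3 ∧ (UTriple b c d 2 3 3 ∨ UTriple b c d 2 3 4 ∨ UTriple b c d 2 3 5)) ∨
      (a = 4 ∧ (UTriple b c d 2 3 4 ∨ UTriple b c d 2 3 5)) ∨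
      (a = 5 ∧ UTriple b c d 2 3 5) ∨
      (4 ≤ a ∧ UTriple b c d 2 3 3) ∨
      (5 ≤ a ∧ UTriple b c d 2 3 4) ∨
      (6 ≤ a ∧ UTriple b c d 2 3 5)) :
    (1 : ℚ) < 1 / a + ((a : ℚ) - 1) / ((a : ℚ) * b) + ((a : ℚ) - 1) / ((a : ℚ) * c) +
      ((a : ℚ) - 1) / ((a : ℚ) * d) := by
  refine one_lt_weight_sum_of_one_lt_sum_inv (by exact_mod_cast ha) ?_
  rcases hfam with h | ⟨-, ⟨s, hs, h⟩ | h | h | h⟩ | ⟨-, s, hs, h⟩ | ⟨s, hs, -, h⟩ |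
    ⟨-, h | h | h⟩ | ⟨-, h | h⟩ | ⟨-, h⟩ | ⟨-, h⟩ | ⟨-, h⟩ | ⟨-, h⟩
  · exact one_lt_sum_inv_of_eq_one hb hc hd h
  all_goals first
    | exact h.one_lt_sum_inv_of_two_two (by omega)
    | exact h.one_lt_sum_inv_of_two_three (by norm_num) (by norm_num)
end

section
/- Let a, b, c, d be integers ≥ 2 and let f = z_0^a z_2 + z_0 z_1^b + z_2^c z_3 + z_1 z_3^d ∈ ℂ[z_0,z_1,z_2,z_3] (Type XIX of the classification, in the variables x = z_0, y = z_1, z = z_2, w = z_3). Then the Milnor number of f satisfies μ(f) = abcd; that is, the complex dimension of ℂ[z_0,z_1,z_2,z_3]/(∂f/∂z_0, ∂f/∂z_1, ∂f/∂z_2, ∂f/∂z_3) equals abcd. -/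
open MvPolynomial

namespace BinomialRewriting

variable {σ : Type*}

/-- One rewriting step `X i ^ n i ↦ monomial (r i)` on exponent vectors; the first component counts
how often each rule has been used. -/
def Step (n : σ → ℕ) (r : σ → σ →₀ ℕ) (p q : (σ →₀ ℕ) × (σ →₀ ℕ)) : Prop :=
  ∃ i x, p.2 = x + Finsupp.single i (n i) ∧ q = (p.1 + Finsupp.single i 1, x + r i)

/-- Reachability by finitely many rewriting steps. -/
abbrev Reach (n : σ → ℕ) (r : σ → σ →₀ ℕ) :
    (σ →₀ ℕ) × (σ →₀ ℕ) → (σ →₀ ℕ) × (σ →₀ ℕ) → Prop :=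
  Relation.ReflTransGen (Step n r)

/-- The exponent vectors to which no rule applies. -/
def Stable (n : σ → ℕ) (e : σ →₀ ℕ) : Prop := ∀ i, e i < n i

variable {n : σ → ℕ} {r : σ → σ →₀ ℕ}

lemma Stable.not_step {p q : (σ →₀ ℕ) × (σ →₀ ℕ)} (hp : Stable n p.2) : ¬ Step n r p q := by
  rintro ⟨i, x, hx, -⟩
  have h := hp i
  rw [hx] at h
  simp at h

lemma exists_step_of_not_stable {p : (σ →₀ ℕ) × (σ →₀ ℕ)} (hp : ¬ Stable n p.2) :
    ∃ q, Step n r p q := by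
  simp only [Stable, not_forall, not_lt] at hp
  obtain ⟨i, hi⟩ := hp
  exact ⟨_, i, p.2 - Finsupp.single i (n i),
    (tsub_add_cancel_of_le (Finsupp.single_le_iff.2 hi)).symm, rfl⟩

lemma Stable.eq_of_reach {p q : (σ →₀ ℕ) × (σ →₀ ℕ)} (hp : Stable n p.2) (h : Reach n r p q) :
    q = p := by
  rcases Relation.ReflTransGen.cases_head h with h | ⟨s, hs, -⟩
  · exact h.symm
  · exact absurd hs hp.not_step

lemma Step.diamond {p q s : (σ →₀ ℕ) × (σ →₀ ℕ)} (hq : Step n r p q) (hs : Step n r p s) :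
    ∃ t, Relation.ReflGen (Step n r) q t ∧ Reach n r s t := by
  classical
  obtain ⟨i, x, hx, rfl⟩ := hq
  obtain ⟨j, y, hy, rfl⟩ := hs
  by_cases hij : i = j
  · subst hij
    have : x = y := add_right_cancel (hx.symm.trans hy)
    subst this
    exact ⟨_, .refl, .refl⟩
  · have hxy := hx.symm.trans hy
    have hj : Finsupp.single j (n j) ≤ x := by
      rw [Finsupp.single_le_iff]
      have := DFunLike.congr_fun hxy j
      simp [hij] at this
      omega
    obtain ⟨z, rfl⟩ := exists_add_of_le hj
    have hyz : y = z + Finsupp.single i (n i) := by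
      apply add_right_cancel (b := Finsupp.single j (n j))
      rw [← hxy]; abel
    subst hyz
    refine ⟨(p.1 + Finsupp.single i 1 + Finsupp.single j 1, z + r i + r j),
      .single ⟨j, z + r i, ?_, rfl⟩, .single ⟨i, z + r j, ?_, ?_⟩⟩
    · simp only; abel
    · simp only; abel
    · ext1
      · simp only; abel
      · simp only; abel

lemma Reach.eq_of_stable {p q s : (σ →₀ ℕ) × (σ →₀ ℕ)} (hq : Reach n r p q) (hs : Reach n r p s)
    (hs' : Stable n s.2) : Reach n r q s := by
  obtain ⟨t, hqt, hst⟩ := Relation.church_rosser (fun _ _ _ h h' => h.diamond h') hq hs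
  rwa [hs'.eq_of_reach hst] at hqt

lemma Reach.translate {p q : (σ →₀ ℕ) × (σ →₀ ℕ)} (h : Reach n r p q) (v : σ →₀ ℕ) :
    Reach n r (v + p.1, p.2) (v + q.1, q.2) := by
  refine Relation.ReflTransGen.lift
    (fun p : (σ →₀ ℕ) × (σ →₀ ℕ) => (v + p.1, p.2)) ?_ _ _ h
  rintro p _ ⟨i, x, hx, rfl⟩
  exact ⟨i, x, hx, by simp [add_assoc]⟩

lemma Reach.exists_eq_add {v e : σ →₀ ℕ} {q : (σ →₀ ℕ) × (σ →₀ ℕ)} (h : Reach n r (v, e) q) :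
    ∃ u, q.1 = v + u ∧ Reach n r (0, e) (u, q.2) := by
  induction h with
  | refl => exact ⟨0, by simp, .refl⟩
  | tail _ hs ih =>
    obtain ⟨u, hu, hr⟩ := ih
    obtain ⟨i, x, hx, rfl⟩ := hs
    exact ⟨u + Finsupp.single i 1, by simp [hu, add_assoc], hr.tail ⟨i, x, hx, rfl⟩⟩

/-- The scalar accumulated by using the rule `i` exactly `u i` times. -/
noncomputable def scalar {K : Type*} [CommSemiring K] (k : σ → K) (u : σ →₀ ℕ) : K :=
  u.prod fun i m => k i ^ m

lemma scalar_add {K : Type*} [CommSemiring K] (k : σ → K) (u v : σ →₀ ℕ) :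
    scalar k (u + v) = scalar k u * scalar k v :=
  Finsupp.prod_add_index' (by simp) (by simp [pow_add])

@[simp] lemma scalar_zero {K : Type*} [CommSemiring K] (k : σ → K) : scalar k 0 = 1 := by
  simp [scalar]

@[simp] lemma scalar_single {K : Type*} [CommSemiring K] (k : σ → K) (i : σ) :
    scalar k (Finsupp.single i 1) = k i := by
  simp [scalar]

lemma scalar_ne_zero {K : Type*} [Field K] {k : σ → K} (hk : ∀ i, k i ≠ 0) (u : σ →₀ ℕ) :
    scalar k u ≠ 0 :=
  Finset.prod_ne_zero_iff.2 fun i _ => pow_ne_zero _ (hk i)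

variable {K : Type*} [Field K] {k : σ → K}

open Classical in
/-- The normal form of a monomial: the scaled stable monomial it rewrites to, or zero if there is
none. -/
noncomputable def normalMonomial (n : σ → ℕ) (r : σ → σ →₀ ℕ) (k : σ → K) (e : σ →₀ ℕ) :
    MvPolynomial σ K :=
  if h : ∃ q : (σ →₀ ℕ) × (σ →₀ ℕ), Reach n r (0, e) q ∧ Stable n q.2 then
    monomial h.choose.2 (scalar k h.choose.1)
  else 0

lemma normalMonomial_of_reach {e u s : σ →₀ ℕ} (h : Reach n r (0, e) (u, s)) (hs : Stable n s) :
    normalMonomial n r k e = monomial s (scalar k u) := by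
  have hex : ∃ q : (σ →₀ ℕ) × (σ →₀ ℕ), Reach n r (0, e) q ∧ Stable n q.2 := ⟨_, h, hs⟩
  have heq : hex.choose = (u, s) :=
    (Stable.eq_of_reach (p := (u, s)) hs (h.eq_of_stable hex.choose_spec.1 hex.choose_spec.2))
  rw [normalMonomial, dif_pos hex, heq]

lemma normalMonomial_of_stable {e : σ →₀ ℕ} (he : Stable n e) :
    normalMonomial n r k e = monomial e 1 := by
  rw [normalMonomial_of_reach .refl he, scalar_zero]

lemma normalMonomial_add_single (i : σ) (x : σ →₀ ℕ) :
    normalMonomial n r k (x + Finsupp.single i (n i)) = k i • normalMonomial n r k (x + r i) := by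
  have hstep : Reach n r (0, x + Finsupp.single i (n i)) (Finsupp.single i 1, x + r i) :=
    .single ⟨i, x, rfl, by simp⟩
  by_cases h : ∃ q : (σ →₀ ℕ) × (σ →₀ ℕ), Reach n r (0, x + r i) q ∧ Stable n q.2
  · obtain ⟨⟨u, s⟩, hr, hs⟩ := h
    have hr' := hr.translate (Finsupp.single i 1)
    rw [add_zero] at hr'
    rw [normalMonomial_of_reach hr hs, normalMonomial_of_reach (hstep.trans hr') hs, scalar_add,
      scalar_single, smul_monomial, smul_eq_mul]
  · have h' : ¬ ∃ q : (σ →₀ ℕ) × (σ →₀ ℕ),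
        Reach n r (0, x + Finsupp.single i (n i)) q ∧ Stable n q.2 := by
      rintro ⟨q, hr, hs⟩
      obtain ⟨u, -, hu⟩ := (hstep.eq_of_stable hr hs).exists_eq_add
      exact h ⟨_, hu, hs⟩
    rw [normalMonomial, normalMonomial, dif_neg h, dif_neg h', smul_zero]

/-- The linear extension of `normalMonomial`. -/
noncomputable def normalForm (n : σ → ℕ) (r : σ → σ →₀ ℕ) (k : σ → K) :
    MvPolynomial σ K →ₗ[K] MvPolynomial σ K :=
  (basisMonomials σ K).constr K (normalMonomial n r k)

lemma normalForm_monomial (e : σ →₀ ℕ) (c : K) :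
    normalForm n r k (monomial e c) = c • normalMonomial n r k e := by
  have h := (basisMonomials σ K).constr_basis K (normalMonomial n r k) e
  rw [coe_basisMonomials] at h
  rw [← mul_one c, ← smul_eq_mul, ← smul_monomial, map_smul, smul_eq_mul, mul_one]
  exact congrArg _ h

/-- The ideal generated by the binomials `X i ^ n i - k i * monomial (r i)`. -/
noncomputable def binomialIdeal (n : σ → ℕ) (r : σ → σ →₀ ℕ) (k : σ → K) :
    Ideal (MvPolynomial σ K) :=
  Ideal.span (Set.range fun i =>
    monomial (Finsupp.single i (n i)) (1 : K) - monomial (r i) (k i))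

lemma normalForm_eq_zero {p : MvPolynomial σ K} (hp : p ∈ binomialIdeal n r k) :
    normalForm n r k p = 0 := by
  suffices h : ∀ q, normalForm n r k (q * p) = 0 by simpa using h 1
  refine Submodule.span_induction
    (p := fun p _ => ∀ q, normalForm n r k (q * p) = 0) ?_ ?_ ?_ ?_ hp
  · rintro _ ⟨i, rfl⟩ q
    induction q using MvPolynomial.induction_on' with
    | monomial x c =>
      simp only [mul_sub, monomial_mul, map_sub, normalForm_monomial, normalMonomial_add_single]
      rw [smul_smul, mul_one, sub_self]
    | add p q hp hq => rw [add_mul, map_add, hp, hq, add_zero]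
  · simp
  · intro x y _ _ hx hy q
    rw [mul_add, map_add, hx, hy, add_zero]
  · intro a x _ hx q
    rw [smul_eq_mul, ← mul_assoc, hx]

lemma mk_add_single (i : σ) (x : σ →₀ ℕ) :
    Ideal.Quotient.mkₐ K (binomialIdeal n r k) (monomial (x + Finsupp.single i (n i)) 1) =
      k i • Ideal.Quotient.mkₐ K (binomialIdeal n r k) (monomial (x + r i) 1) := by
  rw [← map_smul, ← sub_eq_zero, ← map_sub, Ideal.Quotient.mkₐ_eq_mk,
    Ideal.Quotient.eq_zero_iff_mem]
  have h : monomial (Finsupp.single i (n i)) (1 : K) - monomial (r i) (k i) ∈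
      binomialIdeal n r k := Ideal.subset_span ⟨i, rfl⟩
  convert Ideal.mul_mem_left _ (monomial x 1) h using 1
  simp [mul_sub, monomial_mul, smul_monomial]

lemma Reach.smul_mk_eq {p q : (σ →₀ ℕ) × (σ →₀ ℕ)} (h : Reach n r p q) :
    scalar k p.1 • Ideal.Quotient.mkₐ K (binomialIdeal n r k) (monomial p.2 1) =
      scalar k q.1 • Ideal.Quotient.mkₐ K (binomialIdeal n r k) (monomial q.2 1) := by
  induction h with
  | refl => rfl
  | tail _ hs ih =>
    obtain ⟨i, x, hx, rfl⟩ := hs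
    rw [ih, hx, mk_add_single, scalar_add, scalar_single, mul_smul]

lemma Reach.balance {p q : (σ →₀ ℕ) × (σ →₀ ℕ)} (h : Reach n r p q) :
    q.2 + Finsupp.linearCombination ℕ (fun i => Finsupp.single i (n i)) q.1 +
        Finsupp.linearCombination ℕ r p.1 =
      p.2 + Finsupp.linearCombination ℕ (fun i => Finsupp.single i (n i)) p.1 +
        Finsupp.linearCombination ℕ r q.1 := by
  induction h with
  | refl => rfl
  | @tail q s _ hs ih =>
    obtain ⟨i, x, hx, rfl⟩ := hs
    rw [hx] at ih
    simp only [map_add, Finsupp.linearCombination_single, one_smul]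
    calc _ = (x + Finsupp.single i (n i) +
          Finsupp.linearCombination ℕ (fun i => Finsupp.single i (n i)) q.1 +
          Finsupp.linearCombination ℕ r p.1) + r i := by abel
      _ = _ := by rw [ih]; abel

lemma Step.weight_eq {w : σ → ℕ} (hw : ∀ i, Finsupp.weight w (r i) = n i * w i)
    {p q : (σ →₀ ℕ) × (σ →₀ ℕ)} (h : Step n r p q) :
    Finsupp.weight w q.2 = Finsupp.weight w p.2 := by
  obtain ⟨i, x, hx, rfl⟩ := h
  simp [hx, hw, Finsupp.weight_single]

lemma Step.fst_lt {p q : (σ →₀ ℕ) × (σ →₀ ℕ)} (h : Step n r p q) : p.1 < q.1 := by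
  obtain ⟨i, x, hx, rfl⟩ := h
  refine lt_add_of_pos_right _ (pos_iff_ne_zero.2 ?_)
  simp

lemma mk_eq_zero_of_not_reach_stable [Finite σ] {w : σ → ℕ} (hw0 : ∀ i, w i ≠ 0)
    (hw : ∀ i, Finsupp.weight w (r i) = n i * w i) (hk : ∀ i, k i ≠ 0)
    (hcyc : ∀ u : σ →₀ ℕ, u ≠ 0 →
      Finsupp.linearCombination ℕ (fun i => Finsupp.single i (n i)) u =
        Finsupp.linearCombination ℕ r u → scalar k u ≠ 1)
    {e : σ →₀ ℕ} (he : ∀ q, Reach n r (0, e) q → ¬ Stable n q.2) :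
    Ideal.Quotient.mkₐ K (binomialIdeal n r k) (monomial e 1) = 0 := by
  choose g hg using fun q : {q // Reach n r (0, e) q} => exists_step_of_not_stable (r := r)
    (he q.1 q.2)
  let next : {q // Reach n r (0, e) q} → {q // Reach n r (0, e) q} :=
    fun q => ⟨g q, q.2.tail (hg q)⟩
  let f : ℕ → {q // Reach n r (0, e) q} := fun m => next^[m] ⟨(0, e), .refl⟩
  have hf : ∀ m, Step n r (f m).1 (f (m + 1)).1 := by
    intro m
    simp only [f, Function.iterate_succ_apply']
    exact hg _
  have hmono : StrictMono fun m => (f m).1.1 := strictMono_nat_of_lt_succ fun m => (hf m).fst_lt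
  have hweight : ∀ m, Finsupp.weight w (f m).1.2 ≤ Finsupp.weight w e := by
    intro m
    induction m with
    | zero => exact le_rfl
    | succ m ih => rwa [(hf m).weight_eq hw]
  have hfin := Finsupp.finite_of_nat_weight_le w hw0 (Finsupp.weight w e)
  obtain ⟨i, -, j, -, hij, heq⟩ := Set.infinite_univ.exists_lt_map_eq_of_mapsTo
    (f := fun m => (f m).1.2) (fun m _ => hweight m) hfin
  have hreach : ∀ m, Reach n r (f i).1 (f (i + m)).1 := by
    intro m
    induction m with
    | zero => exact .refl
    | succ m ih => exact ih.tail (hf _)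
  have hr : Reach n r (f i).1 (f j).1 := by
    simpa [Nat.add_sub_cancel' hij.le] using hreach (j - i)
  have hlt := hmono hij
  obtain ⟨v, hv⟩ := exists_add_of_le hlt.le
  simp only at hv heq
  have hv0 : v ≠ 0 := by
    rintro rfl
    simp only [hv, add_zero, lt_self_iff_false] at hlt
  have hbal := hr.balance
  rw [hv, ← heq, map_add, map_add] at hbal
  have hne := hcyc v hv0 (by
    apply add_left_cancel (a := (f i).1.2 +
      Finsupp.linearCombination ℕ (fun i => Finsupp.single i (n i)) (f i).1.1 +
      Finsupp.linearCombination ℕ r (f i).1.1)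
    rw [add_assoc _ _ (Finsupp.linearCombination ℕ r v), ← hbal]
    abel)
  have hsm := hr.smul_mk_eq (k := k)
  rw [hv, ← heq, scalar_add, ← sub_eq_zero, ← sub_smul, smul_eq_zero] at hsm
  have hz := hsm.resolve_left fun h => hne (mul_left_cancel₀ (scalar_ne_zero hk (f i).1.1)
    (by rw [mul_one]; exact (sub_eq_zero.1 h).symm))
  have hstart := (f i).2.smul_mk_eq (k := k)
  simpa [hz] using hstart

/-- If the rewriting rules preserve a positive weight and every cycle of rewritings multiplies by a
scalar other than one, then the stable monomials form a basis of the quotient. -/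
theorem finrank_quotient_binomialIdeal [Fintype σ] {w : σ → ℕ} (hw0 : ∀ i, w i ≠ 0)
    (hw : ∀ i, Finsupp.weight w (r i) = n i * w i) (hk : ∀ i, k i ≠ 0)
    (hcyc : ∀ u : σ →₀ ℕ, u ≠ 0 →
      Finsupp.linearCombination ℕ (fun i => Finsupp.single i (n i)) u =
        Finsupp.linearCombination ℕ r u → scalar k u ≠ 1) :
    Module.finrank K (MvPolynomial σ K ⧸ binomialIdeal n r k) = ∏ i, n i := by
  classical
  let ex : (∀ i, Fin (n i)) → σ →₀ ℕ := fun t => Finsupp.equivFunOnFinite.symm fun i => t i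
  have hstable : ∀ t, Stable n (ex t) := fun t i => (t i).2
  have hex : Function.Injective ex := by
    intro s t h
    ext i
    exact DFunLike.congr_fun h i
  let v : (∀ i, Fin (n i)) → MvPolynomial σ K := fun t => monomial (ex t) 1
  have hv : LinearIndependent K v := by
    have h := (basisMonomials σ K).linearIndependent.comp ex hex
    rwa [coe_basisMonomials] at h
  let π := (Ideal.Quotient.mkₐ K (binomialIdeal n r k)).toLinearMap
  have hdisj : Disjoint (Submodule.span K (Set.range v)) (LinearMap.ker π) := by
    rw [Submodule.disjoint_def]
    intro x hx hx'
    have h0 : normalForm n r k x = 0 := by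
      apply normalForm_eq_zero
      exact Ideal.Quotient.eq_zero_iff_mem.1 hx'
    have hfix : Set.EqOn (normalForm n r k) (LinearMap.id : MvPolynomial σ K →ₗ[K] _)
        (Submodule.span K (Set.range v)) := by
      apply LinearMap.eqOn_span
      rintro _ ⟨t, rfl⟩
      simp only [v, normalForm_monomial, normalMonomial_of_stable (hstable t), one_smul,
        LinearMap.id_apply]
    exact (hfix hx).symm.trans h0
  have hspan : ⊤ ≤ Submodule.span K (Set.range (π ∘ v)) := by
    rintro y -
    obtain ⟨p, rfl⟩ := Ideal.Quotient.mkₐ_surjective K (binomialIdeal n r k) y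
    induction p using MvPolynomial.induction_on' with
    | add p q hp hq => rw [map_add]; exact add_mem hp hq
    | monomial e c =>
      rw [← mul_one c, ← smul_eq_mul, ← smul_monomial, map_smul]
      apply Submodule.smul_mem
      by_cases h : ∃ q, Reach n r (0, e) q ∧ Stable n q.2
      · obtain ⟨⟨u, s⟩, hr, hs⟩ := h
        have := hr.smul_mk_eq (k := k)
        simp only [scalar_zero, one_smul] at this
        rw [this]
        apply Submodule.smul_mem
        refine Submodule.subset_span ⟨fun i => ⟨s i, hs i⟩, ?_⟩
        have hs' : ex (fun i => ⟨s i, hs i⟩) = s := by ext i; rfl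
        simp only [Function.comp_apply, v, hs']
        rfl
      · rw [mk_eq_zero_of_not_reach_stable hw0 hw hk hcyc fun q hq hs => h ⟨q, hq, hs⟩]
        exact zero_mem _
  rw [Module.finrank_eq_card_basis (Module.Basis.mk (hv.map hdisj) hspan)]
  simp

end BinomialRewriting

open BinomialRewriting

lemma eq_of_loop_balance {a b c d : ℕ} {x y z w : ℤ} (h : 1 < a * b * c * d)
    (hx : a * x = (a - 1) * y + w) (hy : b * y = (b - 1) * w + z)
    (hz : c * z = (c - 1) * x + y) (hw : d * w = (d - 1) * z + x) :
    y = x ∧ z = x ∧ w = x := by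
  have h0 : (x - y) * ((a * b * c * d : ℕ) - 1 : ℤ) = 0 := by
    push_cast
    linear_combination (b * c * d : ℤ) * hx - (c * d : ℤ) * hy + (c : ℤ) * hw - hz
  have hne : ((a * b * c * d : ℕ) - 1 : ℤ) ≠ 0 := by omega
  have hxy : y = x := by
    have := (mul_eq_zero.1 h0).resolve_right hne
    omega
  subst hxy
  have hwy : w = y := by linear_combination -hx
  subst hwy
  exact ⟨rfl, by linear_combination -hy, rfl⟩

/-- Milnor number formula for Type XIX:  for `f = z_0^a z_2 + z_0 z_1^b + z_2^c z_3 + z_1 z_3^d`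
with `a, b, c, d ≥ 2`, the complex dimension of the Milnor algebra equals `abcd`. -/
theorem milnor_number_type_XIX
    (a b c d : ℕ) (ha : 2 ≤ a) (hb : 2 ≤ b) (hc : 2 ≤ c) (hd : 2 ≤ d) :
    Module.finrank ℂ
      (MvPolynomial (Fin 4) ℂ ⧸
        Ideal.span (Set.range fun i : Fin 4 =>
          pderiv i (X 0 ^ a * X 2 + X 0 * X 1 ^ b + X 2 ^ c * X 3 + X 1 * X 3 ^ d :
            MvPolynomial (Fin 4) ℂ)))
      = a * b * c * d := by
  let n : Fin 4 → ℕ := ![a, b, c, d]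
  let r : Fin 4 → Fin 4 →₀ ℕ :=
    ![Finsupp.single 2 (c - 1) + Finsupp.single 3 1, Finsupp.single 0 (a - 1) + Finsupp.single 2 1,
      Finsupp.single 3 (d - 1) + Finsupp.single 1 1, Finsupp.single 1 (b - 1) + Finsupp.single 0 1]
  let k : Fin 4 → ℂ := ![-c, -a, -d, -b]
  let w : Fin 4 → ℕ :=
    ![(c - 1) * d * b + (b - 1), (a - 1) * c * d + (d - 1), (d - 1) * b * a + (a - 1),
      (b - 1) * a * c + (c - 1)]
  have hprod : 1 < a * b * c * d := by
    have h1 : 0 < b * c * d := by positivity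
    nlinarith
  have hideal : Ideal.span (Set.range fun i : Fin 4 =>
      pderiv i (X 0 ^ a * X 2 + X 0 * X 1 ^ b + X 2 ^ c * X 3 + X 1 * X 3 ^ d :
        MvPolynomial (Fin 4) ℂ)) = binomialIdeal n r k := by
    have hs : Function.Surjective (![2, 0, 3, 1] : Fin 4 → Fin 4) := by decide
    rw [← hs.range_comp, binomialIdeal]
    congr 2
    funext i
    have hm : ∀ (i j : Fin 4) (s t : ℕ) (q : ℂ),
        monomial (Finsupp.single i s + Finsupp.single j t) q = C q * (X i ^ s * X j ^ t) := by
      intro i j s t q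
      simp [X_pow_eq_monomial, monomial_mul, C_mul_monomial]
    fin_cases i <;>
      simp [-Finsupp.single_tsub, n, r, k, hm, pderiv_X, Derivation.leibniz, Derivation.leibniz_pow, Pi.single_apply,
        ← X_pow_eq_monomial] <;> ring
  rw [hideal, finrank_quotient_binomialIdeal (w := w)]
  · simp [n, Fin.prod_univ_four]
  · intro i
    fin_cases i <;> simp [w] <;> intros <;> omega
  · obtain ⟨a, rfl⟩ := Nat.exists_eq_add_of_le' ha
    obtain ⟨b, rfl⟩ := Nat.exists_eq_add_of_le' hb
    obtain ⟨c, rfl⟩ := Nat.exists_eq_add_of_le' hc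
    obtain ⟨d, rfl⟩ := Nat.exists_eq_add_of_le' hd
    intro i
    fin_cases i <;> simp [w, r, n, Finsupp.weight_single] <;> ring
  · intro i
    fin_cases i <;> simp [k] <;> omega
  · intro u hu hbal
    have hev := fun j => DFunLike.congr_fun hbal j
    simp only [Finsupp.linearCombination_apply] at hev
    simp only [Finsupp.sum_fintype, zero_smul, implies_true, Fin.sum_univ_four] at hev
    have h0 := hev 0
    have h1 := hev 1
    have h2 := hev 2
    have h3 := hev 3
    simp [-Finsupp.single_tsub, n, r] at h0 h1 h2 h3
    zify [(by omega : 1 ≤ a), (by omega : 1 ≤ b), (by omega : 1 ≤ c), (by omega : 1 ≤ d)]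
      at h0 h1 h2 h3
    obtain ⟨e1, e2, e3⟩ := eq_of_loop_balance hprod (x := u 0) (y := u 1) (z := u 2) (w := u 3)
      (by linear_combination h0) (by linear_combination h1) (by linear_combination h2)
      (by linear_combination h3)
    norm_cast at e1 e2 e3
    have hu0 : u 0 ≠ 0 := by
      intro h
      apply hu
      ext j
      fin_cases j <;> simp [*]
    have hscalar : scalar k u = ((a * b * c * d : ℕ) ^ u 0 : ℂ) := by
      rw [scalar, Finsupp.prod_fintype _ _ (by simp)]
      simp only [Fin.prod_univ_four, e1, e2, e3, ← mul_pow]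
      congr 1
      simp [k]
      ring
    rw [hscalar]
    exact_mod_cast (one_lt_pow₀ hprod hu0).ne'
end
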